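/- Let σ ≥ 1 be a real number. Let a⁰, b⁰ : ℤ³ → ℂ be Hermitian-symmetric with ‖a⁰‖_{h^σ} < ∞ and ‖b⁰‖_{h^{σ−1}} < ∞. Then there exists exactly one function a : ℝ → (ℤ³ → ℂ) with the following properties: (i) for each n ∈ ℤ³ the map t ↦ a(t)(n) is twice continuously differentiable; (ii) a(t) is Hermitian-symmetric for every t; (iii) for every T > 0, sup_{t∈[−T,T]} (‖a(t)‖_{h^σ} + ‖(∂_t a)(t)‖_{h^{σ−1}}) < ∞; (iv) for every t ∈ ℝ and n ∈ ℤ³, the family (m,k) ↦ a(t)(m)·a(t)(k)·a(t)(n−m−k) is summable over ℤ³ × ℤ³ and (∂_t² a)(t)(n) = −|n|² a(t)(n) − ∑_{(m,k)∈ℤ³×ℤ³} a(t)(m) a(t)(k) a(t)(n−m−k); (v) a(0) = a⁰ and (∂_t a)(0) = b⁰. -/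

import Mathlib

open scoped ENNReal NNReal BigOperators

noncomputable section

/-- The square of the Euclidean norm of a lattice point `n ∈ ℤ³`, as an integer. -/
def nsqZ (n : Fin 3 → ℤ) : ℤ := ∑ i, (n i)^2

/-- The squared Sobolev norm `‖a‖²_{h^σ} = ∑_{n∈ℤ³} ⟨n⟩^{2σ}|a(n)|²` in `[0,∞]`,
with `⟨n⟩^{2σ} = (1+|n|²)^σ`. -/
def hNormSq (σ : ℝ) (a : (Fin 3 → ℤ) → ℂ) : ℝ≥0∞ :=
  ∑' n : Fin 3 → ℤ, ENNReal.ofReal ((1 + (nsqZ n : ℝ)) ^ σ) * (‖a n‖₊ : ℝ≥0∞)^2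

/-- Hermitian symmetry `a(−n) = conj(a(n))`, corresponding to real-valued `u`. -/
def HermSymm (a : (Fin 3 → ℤ) → ℂ) : Prop :=
  ∀ n, a (-n) = (starRingEnd ℂ) (a n)

/-- The lattice `ℤ³`. -/
abbrev ZZ3 := Fin 3 → ℤ

/-- Japanese bracket. -/
def jb (n : ZZ3) : ℝ := Real.sqrt (1 + (nsqZ n : ℝ))

lemma nsqZ_nonneg (n : ZZ3) : 0 ≤ nsqZ n := Finset.sum_nonneg fun i _ => sq_nonneg _

lemma nsqR_nonneg (n : ZZ3) : (0:ℝ) ≤ (nsqZ n : ℝ) := by exact_mod_cast nsqZ_nonneg n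

lemma jb_sq (n : ZZ3) : jb n ^ 2 = 1 + (nsqZ n : ℝ) :=
  Real.sq_sqrt (by have := nsqR_nonneg n; linarith)

lemma one_le_jb (n : ZZ3) : 1 ≤ jb n := by
  rw [jb, Real.one_le_sqrt]; have := nsqR_nonneg n; linarith

lemma jb_pos (n : ZZ3) : 0 < jb n := lt_of_lt_of_le one_pos (one_le_jb n)

lemma nsqZ_neg (n : ZZ3) : nsqZ (-n) = nsqZ n := by simp [nsqZ]

lemma jb_neg (n : ZZ3) : jb (-n) = jb n := by simp [jb, nsqZ_neg]

lemma jb_add_le (m k : ZZ3) : jb (m + k) ≤ jb m + jb k := by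
  have hm := jb_pos m
  have hk := jb_pos k
  apply Real.sqrt_le_iff.2
  refine ⟨by linarith, ?_⟩
  have e1 : (nsqZ (m + k) : ℝ) = nsqZ m + nsqZ k + 2 * ∑ i, (m i : ℝ) * (k i : ℝ) := by
    simp only [nsqZ, Fin.sum_univ_three, Pi.add_apply]; push_cast; ring
  have hcs : (∑ i, (m i : ℝ) * (k i : ℝ)) ≤ jb m * jb k := by
    apply le_of_sq_le_sq _ (by positivity)
    have h := Finset.sum_mul_sq_le_sq_mul_sq Finset.univ (fun i => (m i : ℝ)) (fun i => (k i : ℝ))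
    have h1 : (∑ i, (m i : ℝ)^2) = nsqZ m := by simp [nsqZ]
    have h2 : (∑ i, (k i : ℝ)^2) = nsqZ k := by simp [nsqZ]
    rw [h1, h2] at h
    rw [mul_pow, jb_sq, jb_sq]
    have := nsqR_nonneg m
    have := nsqR_nonneg k
    nlinarith
  have := jb_sq m
  have := jb_sq k
  nlinarith

lemma abs_le_jb (n : ZZ3) (i : Fin 3) : |(n i : ℝ)| ≤ jb n := by
  apply Real.le_sqrt_of_sq_le
  rw [sq_abs]
  have : (n i)^2 ≤ nsqZ n := Finset.single_le_sum (f := fun i => (n i)^2) (fun i _ => sq_nonneg _) (Finset.mem_univ i)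
  have h2 : ((n i : ℝ))^2 ≤ nsqZ n := by exact_mod_cast this
  linarith

/-- The box of radius `N`. -/
def boxN (N : ℕ) : Finset ZZ3 := Fintype.piFinset (fun _ => Finset.Icc (-(N:ℤ)) N)

lemma mem_boxN {N : ℕ} {n : ZZ3} : n ∈ boxN N ↔ ∀ i, |n i| ≤ N := by
  simp [boxN, Fintype.mem_piFinset, abs_le]

lemma card_boxN (N : ℕ) : (boxN N).card = (2*N+1)^3 := by
  simp only [boxN, Fintype.card_piFinset, Int.card_Icc, Finset.prod_const, Finset.card_univ, Fintype.card_fin]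
  congr 1; omega

lemma boxN_mono (N : ℕ) : boxN N ⊆ boxN (N+1) := by
  intro n hn
  rw [mem_boxN] at *
  intro i; have := hn i; push_cast; linarith

lemma jb_of_not_mem {N : ℕ} {n : ZZ3} (h : n ∉ boxN N) : (N:ℝ) + 1 ≤ jb n := by
  rw [mem_boxN] at h; push Not at h
  obtain ⟨i, hi⟩ := h
  have h1 : (N:ℤ) + 1 ≤ |n i| := by omega
  have h2 : (N:ℝ) + 1 ≤ |(n i : ℝ)| := by exact_mod_cast h1
  exact h2.trans (abs_le_jb n i)

lemma card_shell (N : ℕ) : ((boxN (N+1) \ boxN N).card : ℝ) ≤ 26 * ((N:ℝ)+1)^2 := by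
  rw [Finset.card_sdiff_of_subset (boxN_mono N), Nat.cast_sub (Finset.card_le_card (boxN_mono N)), card_boxN, card_boxN]
  push_cast
  nlinarith [(Nat.cast_nonneg N : (0:ℝ) ≤ N)]

lemma sum_box (N : ℕ) (e : ℕ) (he : e ≤ 2) :
    ∑ k ∈ boxN N, (1 / jb k ^ e) ≤ 1 + 26 * ∑ i ∈ Finset.range N, ((i:ℝ)+1)^(2-e) := by
  induction N with
  | zero =>
    have : (boxN 0) = {0} := by
      ext n; rw [mem_boxN]; simp [funext_iff]
    rw [this]; simp [jb, nsqZ]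
  | succ N ih =>
    rw [Finset.sum_range_succ, ← Finset.sum_sdiff (boxN_mono N)]
    have : ∑ k ∈ boxN (N+1) \ boxN N, (1 / jb k ^ e) ≤ 26 * ((N:ℝ)+1)^(2-e) := by
      calc _ ≤ ∑ k ∈ boxN (N+1) \ boxN N, (1 / ((N:ℝ)+1) ^ e) := by
            apply Finset.sum_le_sum
            intro k hk
            have := jb_of_not_mem (Finset.mem_sdiff.1 hk).2
            gcongr
        _ = ((boxN (N+1) \ boxN N).card : ℝ) * (1 / ((N:ℝ)+1) ^ e) := by simp
        _ ≤ 26 * ((N:ℝ)+1)^2 * (1 / ((N:ℝ)+1) ^ e) := by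
            gcongr; exact card_shell N
        _ = 26 * ((N:ℝ)+1)^(2-e) := by
            rw [pow_sub₀ _ (by positivity) he]; field_simp
    linarith

/-- inverse bracket as extended nonneg real -/
def jw (n : ZZ3) : ℝ≥0∞ := ENNReal.ofReal (1 / jb n)

lemma tsum_jw_le (R : ℝ) (hR : 1 ≤ R) (e : ℕ) (he : e ≤ 2) :
    ∑' k : ZZ3, (if jb k ≤ R then jw k ^ e else 0) ≤ ENNReal.ofReal (27 * R ^ (3 - e)) := by
  classical
  set N := ⌊R⌋₊ with hN
  have hNR : (N:ℝ) ≤ R := Nat.floor_le (by linarith)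
  rw [tsum_eq_sum (s := boxN N)]
  · calc _ ≤ ∑ k ∈ boxN N, ENNReal.ofReal (1 / jb k ^ e) := by
          apply Finset.sum_le_sum
          intro k _
          split_ifs
          · rw [jw, ← ENNReal.ofReal_pow (by have := jb_pos k; positivity)]
            simp
          · simp
      _ = ENNReal.ofReal (∑ k ∈ boxN N, (1 / jb k ^ e)) := by
          rw [ENNReal.ofReal_sum_of_nonneg]
          intro k _; have := jb_pos k; positivity
      _ ≤ _ := by
          apply ENNReal.ofReal_le_ofReal
          refine (sum_box N e he).trans ?_
          have h1 : ∑ i ∈ Finset.range N, ((i:ℝ)+1)^(2-e) ≤ ∑ i ∈ Finset.range N, R^(2-e) := by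
            apply Finset.sum_le_sum
            intro i hi
            have : (i:ℝ) + 1 ≤ N := by exact_mod_cast Finset.mem_range.1 hi
            gcongr; linarith
          have h2 : ∑ i ∈ Finset.range N, R^(2-e) ≤ R ^ (3-e) := by
            have : 3 - e = (2 - e) + 1 := by omega
            simp only [Finset.sum_const, Finset.card_range, nsmul_eq_mul]
            rw [this, pow_succ, mul_comm]
            gcongr
          have h3 : 1 ≤ R ^ (3-e) := one_le_pow₀ hR
          linarith
  · intro k hk
    rw [if_neg]
    intro h
    apply hk
    rw [mem_boxN]
    intro i
    have h1 := (abs_le_jb k i).trans h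
    have : |k i|.toNat ≤ N := by
      apply Nat.le_floor
      have h0 : ((|k i|.toNat : ℕ) : ℤ) = |k i| := Int.toNat_of_nonneg (abs_nonneg _)
      have : ((|k i|.toNat : ℕ) : ℝ) = |(k i : ℝ)| := by exact_mod_cast congrArg (Int.cast : ℤ → ℝ) h0
      rw [this]; exact h1
    omega

lemma enn_cs {ι : Type*} (f g : ι → ℝ≥0∞) :
    (∑' i, f i * g i)^2 ≤ (∑' i, f i ^ 2) * (∑' i, g i ^ 2) := by
  have hfin : ∀ s : Finset ι, (∑ i ∈ s, f i * g i)^2 ≤ (∑' i, f i ^ 2) * (∑' i, g i ^ 2) := by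
    intro s
    have h := ENNReal.inner_le_Lp_mul_Lq s f g (p := 2) (q := 2) (by constructor <;> norm_num)
    have h2 : (∑ i ∈ s, f i * g i)^2 ≤ (∑ i ∈ s, f i ^ 2) * (∑ i ∈ s, g i ^ 2) := by
      calc _ ≤ ((∑ i ∈ s, f i ^ (2:ℝ)) ^ (1 / (2:ℝ)) * (∑ i ∈ s, g i ^ (2:ℝ)) ^ (1 / (2:ℝ)))^2 := by
            gcongr
        _ = _ := by
            rw [mul_pow, ← ENNReal.rpow_natCast, ← ENNReal.rpow_natCast, ← ENNReal.rpow_mul, ← ENNReal.rpow_mul]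
            norm_num
    exact h2.trans (mul_le_mul' (ENNReal.sum_le_tsum s) (ENNReal.sum_le_tsum s))
  have hc : Filter.Tendsto (fun s : Finset ι => (∑ i ∈ s, f i * g i)^2) Filter.atTop
      (nhds ((∑' i, f i * g i)^2)) :=
    ((ENNReal.continuous_pow 2).tendsto _).comp (ENNReal.summable.hasSum)
  exact le_of_tendsto' hc hfin

lemma enn_cs_w {ι : Type*} (κ f g : ι → ℝ≥0∞) :
    (∑' i, κ i * (f i * g i))^2 ≤ (∑' i, κ i * f i ^ 2) * (∑' i, κ i * g i ^ 2) := by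
  have hκ : ∀ i, (κ i ^ (1/2:ℝ))^2 = κ i := by
    intro i; rw [← ENNReal.rpow_natCast, ← ENNReal.rpow_mul]; norm_num
  have h := enn_cs (fun i => κ i ^ (1/2:ℝ) * f i) (fun i => κ i ^ (1/2:ℝ) * g i)
  simp only [mul_pow, hκ] at h
  refine le_trans (le_of_eq ?_) h
  congr 1
  apply tsum_congr
  intro i
  nth_rewrite 1 [← hκ i]
  ring

lemma enn_add_sq (a b : ℝ≥0∞) : (a+b)^2 ≤ 2 * (a^2 + b^2) := by
  have := ENNReal.rpow_add_le_mul_rpow_add_rpow a b (p := 2) (by norm_num)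
  norm_num at this
  simpa using this

lemma enn_tsum_add_sq {ι : Type*} (f g : ι → ℝ≥0∞) :
    ∑' i, (f i + g i)^2 ≤ 2 * (∑' i, f i ^2 + ∑' i, g i ^2) := by
  rw [← ENNReal.tsum_add, ← ENNReal.tsum_mul_left]
  exact ENNReal.tsum_le_tsum fun i => enn_add_sq _ _

/-- absolute triple convolution -/
def cv (A B C : ZZ3 → ℝ≥0∞) (n : ZZ3) : ℝ≥0∞ :=
  ∑' p : ZZ3 × ZZ3, A p.1 * B p.2 * C (n - p.1 - p.2)

/-- ordered part -/
def ocv (A B C : ZZ3 → ℝ≥0∞) (n : ZZ3) : ℝ≥0∞ :=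
  ∑' p : ZZ3 × ZZ3, if jb (n - p.1 - p.2) ≤ jb p.2 ∧ jb p.2 ≤ jb p.1 then
    A p.1 * B p.2 * C (n - p.1 - p.2) else 0

/-- l2 square sum -/
def sq2 (A : ZZ3 → ℝ≥0∞) : ℝ≥0∞ := ∑' n, A n ^ 2

lemma jw_mul_jb (n : ZZ3) : jw n * ENNReal.ofReal (jb n) = 1 := by
  have := jb_pos n
  rw [jw, ← ENNReal.ofReal_mul (by positivity)]
  rw [one_div, inv_mul_cancel₀ this.ne']; simp

lemma ocv_sq (A B C : ZZ3 → ℝ≥0∞) :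
    sq2 (ocv (fun n => jw n * A n) (fun n => jw n * B n) (fun n => jw n * C n)) ≤
      27^2 * (sq2 A * sq2 B * sq2 C) := by
  classical
  have key : ∀ n, (ocv (fun n => jw n * A n) (fun n => jw n * B n) (fun n => jw n * C n) n)^2 ≤
      (∑' m, ∑' k, (if jb k ≤ jb m then jw k else 0) * (A m * jw m)^2 * C (n-m-k)^2) * (27 * sq2 B) := by
    intro n
    let κ : ZZ3 × ZZ3 → ℝ≥0∞ := fun p =>
      if jb (n - p.1 - p.2) ≤ jb p.2 ∧ jb p.2 ≤ jb p.1 then jw p.2 else 0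
    have h := enn_cs_w κ (fun p => A p.1 * jw p.1 * C (n - p.1 - p.2)) (fun p => B p.2 * jw (n-p.1-p.2))
    have e : ocv (fun n => jw n * A n) (fun n => jw n * B n) (fun n => jw n * C n) n =
        ∑' p, κ p * ((A p.1 * jw p.1 * C (n - p.1 - p.2)) * (B p.2 * jw (n-p.1-p.2))) := by
      apply tsum_congr; intro p
      simp only [κ]
      split_ifs
      · ring
      · simp
    rw [e]
    refine h.trans (mul_le_mul' ?_ ?_)
    · rw [ENNReal.tsum_prod']
      refine ENNReal.tsum_le_tsum fun m => ENNReal.tsum_le_tsum fun k => ?_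
      simp only [κ]
      rw [mul_pow, ← mul_assoc]
      gcongr
      split_ifs with h1 h2 h2
      · rfl
      · exact absurd h1.2 h2
      · simp
      · simp
    · rw [ENNReal.tsum_prod', ENNReal.tsum_comm, sq2, ← ENNReal.tsum_mul_left]
      refine ENNReal.tsum_le_tsum fun k => ?_
      calc _ ≤ ∑' m, jw k * B k^2 * (if jb (n - m - k) ≤ jb k then jw (n-m-k)^2 else 0) := by
            refine ENNReal.tsum_le_tsum fun m => ?_
            simp only [κ]
            split_ifs with h1 h2 h2
            · rw [mul_pow, mul_assoc]
            · exact absurd h1.1 h2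
            · simp
            · simp
        _ = jw k * B k^2 * ∑' l, (if jb l ≤ jb k then jw l^2 else 0) := by
            rw [ENNReal.tsum_mul_left]
            congr 1
            rw [← Equiv.tsum_eq (Equiv.subLeft (n - k)) (fun l => if jb l ≤ jb k then jw l^2 else 0)]
            apply tsum_congr; intro m
            have : (Equiv.subLeft (n-k)) m = n - m - k := by simp; abel
            rw [this]
        _ ≤ jw k * B k^2 * ENNReal.ofReal (27 * jb k) := by
            gcongr
            simpa using tsum_jw_le (jb k) (one_le_jb k) 2 le_rfl
        _ = 27 * B k^2 := by
            rw [ENNReal.ofReal_mul (by norm_num)]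
            have := jw_mul_jb k
            calc _ = (jw k * ENNReal.ofReal (jb k)) * (ENNReal.ofReal 27 * B k^2) := by ring
              _ = _ := by rw [this]; norm_num
  calc _ ≤ ∑' n, (∑' m, ∑' k, (if jb k ≤ jb m then jw k else 0) * (A m * jw m)^2 * C (n-m-k)^2) * (27 * sq2 B) :=
        ENNReal.tsum_le_tsum key
    _ = (∑' m, ∑' k, ∑' n, (if jb k ≤ jb m then jw k else 0) * (A m * jw m)^2 * C (n-m-k)^2) * (27 * sq2 B) := by
        rw [ENNReal.tsum_mul_right, ENNReal.tsum_comm]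
        congr 1
        apply tsum_congr; intro m
        rw [ENNReal.tsum_comm]
    _ = (∑' m, (A m * jw m)^2 * (∑' k, (if jb k ≤ jb m then jw k else 0))) * sq2 C * (27 * sq2 B) := by
        congr 1
        rw [← ENNReal.tsum_mul_right]
        apply tsum_congr; intro m
        rw [mul_assoc, ← ENNReal.tsum_mul_right, ← ENNReal.tsum_mul_left]
        apply tsum_congr; intro k
        rw [ENNReal.tsum_mul_left]
        have : ∑' n, C (n - m - k)^2 = sq2 C := by
          rw [sq2, ← Equiv.tsum_eq (Equiv.subRight (m + k)) (fun n => C n ^ 2)]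
          apply tsum_congr; intro n
          simp [sub_sub]
        rw [this]; ring
    _ ≤ (∑' m, 27 * A m ^2) * sq2 C * (27 * sq2 B) := by
        refine mul_le_mul' (mul_le_mul' (ENNReal.tsum_le_tsum fun m => ?_) le_rfl) le_rfl
        calc _ ≤ (A m * jw m)^2 * ENNReal.ofReal (27 * jb m ^2) := by
              gcongr
              simpa using tsum_jw_le (jb m) (one_le_jb m) 1 (by norm_num)
          _ = 27 * A m^2 := by
            rw [ENNReal.ofReal_mul (by norm_num), ENNReal.ofReal_pow (jb_pos m).le]
            calc _ = (jw m * ENNReal.ofReal (jb m))^2 * (ENNReal.ofReal 27 * A m^2) := by ring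
              _ = _ := by rw [jw_mul_jb]; norm_num
    _ = _ := by rw [ENNReal.tsum_mul_left]; simp only [sq2]; ring

/-- swap first two -/
lemma tsum_sw12 {M : Type*} [AddCommMonoid M] [TopologicalSpace M] (n : ZZ3) (F : ZZ3 → ZZ3 → ZZ3 → M) :
    ∑' p : ZZ3 × ZZ3, F p.1 p.2 (n - p.1 - p.2) = ∑' p : ZZ3 × ZZ3, F p.2 p.1 (n - p.1 - p.2) := by
  rw [← Equiv.tsum_eq (Equiv.prodComm ZZ3 ZZ3)]
  apply tsum_congr; intro p
  have : n - p.2 - p.1 = n - p.1 - p.2 := by abel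
  simp [this]

/-- the equivalence `(m,k) ↦ (m, n-m-k)` -/
def e23 (n : ZZ3) : ZZ3 × ZZ3 ≃ ZZ3 × ZZ3 where
  toFun p := (p.1, n - p.1 - p.2)
  invFun p := (p.1, n - p.1 - p.2)
  left_inv p := by simp
  right_inv p := by simp

lemma tsum_sw23 {M : Type*} [AddCommMonoid M] [TopologicalSpace M] (n : ZZ3) (F : ZZ3 → ZZ3 → ZZ3 → M) :
    ∑' p : ZZ3 × ZZ3, F p.1 p.2 (n - p.1 - p.2) = ∑' p : ZZ3 × ZZ3, F p.1 (n - p.1 - p.2) p.2 := by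
  rw [← Equiv.tsum_eq (e23 n)]
  apply tsum_congr; intro p
  simp [e23]

lemma cv_le (A B C : ZZ3 → ℝ≥0∞) (n : ZZ3) :
    cv A B C n ≤ ((ocv A B C n + ocv A C B n) + (ocv B A C n + ocv B C A n)) + (ocv C A B n + ocv C B A n) := by
  classical
  let P : ZZ3 → ZZ3 → ZZ3 → Prop := fun m k l => jb l ≤ jb k ∧ jb k ≤ jb m
  have h1 : ocv A C B n = ∑' p : ZZ3 × ZZ3, if P p.1 (n-p.1-p.2) p.2 then
      A p.1 * C (n-p.1-p.2) * B p.2 else 0 :=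
    tsum_sw23 n (fun m k l => if P m k l then A m * C k * B l else 0)
  have h2 : ocv B A C n = ∑' p : ZZ3 × ZZ3, if P p.2 p.1 (n-p.1-p.2) then
      B p.2 * A p.1 * C (n-p.1-p.2) else 0 :=
    tsum_sw12 n (fun m k l => if P m k l then B m * A k * C l else 0)
  have h3 : ocv B C A n = ∑' p : ZZ3 × ZZ3, if P p.2 (n-p.1-p.2) p.1 then
      B p.2 * C (n-p.1-p.2) * A p.1 else 0 :=
    (tsum_sw23 n (fun m k l => if P m k l then B m * C k * A l else 0)).trans
      (tsum_sw12 n (fun m k l => if P m l k then B m * C l * A k else 0))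
  have h4 : ocv C A B n = ∑' p : ZZ3 × ZZ3, if P (n-p.1-p.2) p.1 p.2 then
      C (n-p.1-p.2) * A p.1 * B p.2 else 0 :=
    (tsum_sw12 n (fun m k l => if P m k l then C m * A k * B l else 0)).trans
      (tsum_sw23 n (fun m k l => if P k m l then C k * A m * B l else 0))
  have h5 : ocv C B A n = ∑' p : ZZ3 × ZZ3, if P (n-p.1-p.2) p.2 p.1 then
      C (n-p.1-p.2) * B p.2 * A p.1 else 0 :=
    ((tsum_sw23 n (fun m k l => if P m k l then C m * B k * A l else 0)).trans
      (tsum_sw12 n (fun m k l => if P m l k then C m * B l * A k else 0))).trans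
      (tsum_sw23 n (fun m k l => if P k l m then C k * B l * A m else 0))
  have h0 : ocv A B C n = ∑' p : ZZ3 × ZZ3, if P p.1 p.2 (n-p.1-p.2) then
      A p.1 * B p.2 * C (n-p.1-p.2) else 0 := rfl
  rw [h0, h1, h2, h3, h4, h5, ← ENNReal.tsum_add, ← ENNReal.tsum_add, ← ENNReal.tsum_add,
    ← ENNReal.tsum_add, ← ENNReal.tsum_add]
  refine ENNReal.tsum_le_tsum fun p => ?_
  generalize n - p.1 - p.2 = l
  have e1 : A p.1 * C l * B p.2 = A p.1 * B p.2 * C l := by ring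
  have e2 : B p.2 * A p.1 * C l = A p.1 * B p.2 * C l := by ring
  have e3 : B p.2 * C l * A p.1 = A p.1 * B p.2 * C l := by ring
  have e4 : C l * A p.1 * B p.2 = A p.1 * B p.2 * C l := by ring
  have e5 : C l * B p.2 * A p.1 = A p.1 * B p.2 * C l := by ring
  rw [e1, e2, e3, e4, e5]
  generalize A p.1 * B p.2 * C l = x
  have : P p.1 p.2 l ∨ P p.1 l p.2 ∨ P p.2 p.1 l ∨ P p.2 l p.1 ∨ P l p.1 p.2 ∨ P l p.2 p.1 := by
    simp only [P]
    rcases le_total (jb p.1) (jb p.2) with h | h <;> rcases le_total (jb p.1) (jb l) with h' | h' <;>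
      rcases le_total (jb p.2) (jb l) with h'' | h'' <;> tauto
  rcases this with h | h | h | h | h | h <;> rw [if_pos h]
  · exact ((le_add_right le_rfl).trans (le_add_right le_rfl)).trans (le_add_right le_rfl)
  · exact ((le_add_left le_rfl).trans (le_add_right le_rfl)).trans (le_add_right le_rfl)
  · exact ((le_add_right le_rfl).trans (le_add_left le_rfl)).trans (le_add_right le_rfl)
  · exact ((le_add_left le_rfl).trans (le_add_left le_rfl)).trans (le_add_right le_rfl)
  · exact (le_add_right le_rfl).trans (le_add_left le_rfl)
  · exact (le_add_left le_rfl).trans (le_add_left le_rfl)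

lemma cv_sq (A B C : ZZ3 → ℝ≥0∞) :
    sq2 (cv (fun n => jw n * A n) (fun n => jw n * B n) (fun n => jw n * C n)) ≤
      (40 * 27^2) * (sq2 A * sq2 B * sq2 C) := by
  set A' := (fun n => jw n * A n)
  set B' := (fun n => jw n * B n)
  set C' := (fun n => jw n * C n)
  set Y := sq2 A * sq2 B * sq2 C with hY
  have h1 : sq2 (ocv A' B' C') ≤ 27^2 * Y := ocv_sq A B C
  have h2 : sq2 (ocv A' C' B') ≤ 27^2 * Y := (ocv_sq A C B).trans (le_of_eq (by rw [hY]; ring))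
  have h3 : sq2 (ocv B' A' C') ≤ 27^2 * Y := (ocv_sq B A C).trans (le_of_eq (by rw [hY]; ring))
  have h4 : sq2 (ocv B' C' A') ≤ 27^2 * Y := (ocv_sq B C A).trans (le_of_eq (by rw [hY]; ring))
  have h5 : sq2 (ocv C' A' B') ≤ 27^2 * Y := (ocv_sq C A B).trans (le_of_eq (by rw [hY]; ring))
  have h6 : sq2 (ocv C' B' A') ≤ 27^2 * Y := (ocv_sq C B A).trans (le_of_eq (by rw [hY]; ring))
  calc sq2 (cv A' B' C') ≤ ∑' n, (((ocv A' B' C' n + ocv A' C' B' n) + (ocv B' A' C' n + ocv B' C' A' n)) + (ocv C' A' B' n + ocv C' B' A' n))^2 := by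
        refine ENNReal.tsum_le_tsum fun n => ?_
        gcongr
        exact cv_le A' B' C' n
    _ ≤ 2 * (2 * (2 * (27^2 * Y + 27^2*Y) + 2 * (27^2 * Y + 27^2*Y)) + 2 * (27^2 * Y + 27^2*Y)) := by
        refine (enn_tsum_add_sq _ _).trans ?_
        gcongr
        · refine (enn_tsum_add_sq _ _).trans ?_
          gcongr
          · refine (enn_tsum_add_sq _ _).trans ?_
            gcongr <;> assumption
          · refine (enn_tsum_add_sq _ _).trans ?_
            gcongr <;> assumption
        · refine (enn_tsum_add_sq _ _).trans ?_
          gcongr <;> assumption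
    _ = _ := by ring_nf
    _ ≤ _ := le_rfl

/-- The Hilbert space `ℓ²(ℤ³)`. -/
abbrev XX := lp (fun _ : ZZ3 => ℂ) 2

lemma two_toReal_pos : 0 < (2:ℝ≥0∞).toReal := by norm_num

lemma sq2_eq (x : XX) : sq2 (fun n => ‖x n‖ₑ) = ‖x‖ₑ ^ 2 := by
  have h := lp.hasSum_norm two_toReal_pos x
  simp only [ENNReal.toReal_ofNat, Real.rpow_ofNat] at h
  have h2 : ‖x‖ₑ ^ 2 = ENNReal.ofReal (‖x‖^2) := by
    rw [ENNReal.ofReal_pow (norm_nonneg _), ofReal_norm]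
  rw [h2, ← h.tsum_eq, ENNReal.ofReal_tsum_of_nonneg (fun n => by positivity) h.summable]
  apply tsum_congr; intro n
  rw [ENNReal.ofReal_pow (norm_nonneg _), ofReal_norm]

lemma memX {f : ZZ3 → ℂ} (h : sq2 (fun n => ‖f n‖ₑ) ≠ ⊤) : Memℓp f 2 := by
  apply memℓp_gen
  simp only [ENNReal.toReal_ofNat, Real.rpow_ofNat]
  have := ENNReal.summable_toReal h
  simpa using this

/-- multiplier -/
def mulX (μ : ZZ3 → ℂ) (hμ : ∀ n, ‖μ n‖ ≤ 1) : XX →L[ℝ] XX :=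
  LinearMap.mkContinuous
    { toFun := fun x => ⟨fun n => μ n * x n, (lp.memℓp x).mono' (by
        intro n; rw [norm_mul]
        exact mul_le_of_le_one_left (norm_nonneg _) (hμ n))⟩
      map_add' := fun x y => by
        apply lp.ext; funext n
        exact mul_add (μ n) (x n) (y n)
      map_smul' := fun c x => by
        apply lp.ext; funext n
        simp [mul_left_comm] } 1 (by
      intro x
      rw [one_mul]
      apply lp.norm_mono (by norm_num)
      intro n
      simp only [LinearMap.coe_mk, AddHom.coe_mk, norm_mul]
      exact mul_le_of_le_one_left (norm_nonneg _) (hμ n))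

@[simp] lemma mulX_apply (μ : ZZ3 → ℂ) (hμ : ∀ n, ‖μ n‖ ≤ 1) (x : XX) (n : ZZ3) :
    mulX μ hμ x n = μ n * x n := rfl

lemma mulX_norm_le (μ : ZZ3 → ℂ) (hμ : ∀ n, ‖μ n‖ ≤ 1) (x : XX) : ‖mulX μ hμ x‖ ≤ ‖x‖ := by
  apply lp.norm_mono (by norm_num)
  intro n
  rw [mulX_apply, norm_mul]
  exact mul_le_of_le_one_left (norm_nonneg _) (hμ n)

lemma jp_le_one (s : ℝ) (hs : 0 ≤ s) (n : ZZ3) : ‖((jb n ^ (-s) : ℝ) : ℂ)‖ ≤ 1 := by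
  have := jb_pos n
  rw [Complex.norm_real, Real.norm_of_nonneg (by positivity)]
  exact Real.rpow_le_one_of_one_le_of_nonpos (one_le_jb n) (by linarith)

/-- multiplication by `⟨n⟩^{-s}` -/
def DD (s : ℝ) (hs : 0 ≤ s) : XX →L[ℝ] XX := mulX (fun n => ((jb n ^ (-s) : ℝ) : ℂ)) (jp_le_one s hs)

lemma DD_apply (s : ℝ) (hs : 0 ≤ s) (x : XX) (n : ZZ3) : DD s hs x n = ((jb n ^ (-s) : ℝ) : ℂ) * x n := rfl

lemma DD_norm_le (s : ℝ) (hs : 0 ≤ s) (x : XX) : ‖DD s hs x‖ ≤ ‖x‖ := mulX_norm_le _ _ _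

/-- triple convolution -/
def conv3 (f g h : ZZ3 → ℂ) (n : ZZ3) : ℂ :=
  ∑' p : ZZ3 × ZZ3, f p.1 * g p.2 * h (n - p.1 - p.2)

/-- coefficients `⟨n⟩^{-(1+s)} x n` -/
def ja (s : ℝ) (x : XX) (n : ZZ3) : ℂ := ((jb n ^ (-(1+s)) : ℝ) : ℂ) * x n

lemma jb_pow_le (s : ℝ) (hs : 0 ≤ s) (n m k : ZZ3) :
    jb n ^ s ≤ 3 ^ s * (jb m ^ s + jb k ^ s + jb (n - m - k) ^ s) := by
  set l := n - m - k with hl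
  have hn : n = m + k + l := by rw [hl]; abel
  have h1 : jb n ≤ jb m + jb k + jb l := by
    rw [hn]; exact (jb_add_le _ _).trans (by gcongr; exact jb_add_le _ _)
  have hm := jb_pos m
  have hk := jb_pos k
  have hll := jb_pos l
  have hm' := Real.rpow_nonneg hm.le s
  have hk' := Real.rpow_nonneg hk.le s
  have hl' := Real.rpow_nonneg hll.le s
  have key : ∀ x : ℝ, 0 ≤ x → jb n ≤ 3 * x → jb n ^ s ≤ 3 ^ s * x ^ s := by
    intro x hx h
    rw [← Real.mul_rpow (by norm_num) hx]
    exact Real.rpow_le_rpow (jb_pos n).le h hs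
  have h3 : (0:ℝ) < 3 ^ s := by positivity
  rcases le_total (jb m) (jb k) with h | h <;> rcases le_total (jb m) (jb l) with h' | h' <;>
      rcases le_total (jb k) (jb l) with h'' | h''
  all_goals first
    | exact (key (jb m) hm.le (by linarith)).trans (by gcongr; linarith)
    | exact (key (jb k) hk.le (by linarith)).trans (by gcongr; linarith)
    | exact (key (jb l) hll.le (by linarith)).trans (by gcongr; linarith)

lemma enorm_ja (s : ℝ) (hs : 0 ≤ s) (x : XX) (n : ZZ3) :
    ‖ja s x n‖ₑ = jw n * ‖DD s hs x n‖ₑ := by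
  have := jb_pos n
  have h1 : jb n ^ (-(1+s)) = (1 / jb n) * jb n ^ (-s) := by
    rw [neg_add, Real.rpow_add this, Real.rpow_neg_one, one_div]
  have h2 : jw n = ‖((1/jb n : ℝ) : ℂ)‖ₑ := by
    rw [jw, ← ofReal_norm, Complex.norm_real, Real.norm_of_nonneg (by positivity)]
  rw [ja, h1, h2, ← enorm_mul, DD_apply]; push_cast; ring_nf

lemma enorm_ja' (s : ℝ) (hs : 0 ≤ s) (x : XX) (n : ZZ3) :
    ENNReal.ofReal (jb n ^ s) * ‖ja s x n‖ₑ = jw n * ‖x n‖ₑ := by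
  have h0 := jb_pos n
  rw [enorm_ja s hs, DD_apply, enorm_mul]
  have h2 : ENNReal.ofReal (jb n ^ s) * ‖((jb n ^ (-s) : ℝ) : ℂ)‖ₑ = 1 := by
    rw [← ofReal_norm, Complex.norm_real, Real.norm_of_nonneg (by positivity), ← ENNReal.ofReal_mul (by positivity),
      ← Real.rpow_add h0]
    simp
  calc _ = (ENNReal.ofReal (jb n ^ s) * ‖((jb n ^ (-s) : ℝ) : ℂ)‖ₑ) * (jw n * ‖x n‖ₑ) := by ring
    _ = _ := by rw [h2, one_mul]

/-- absolute convolution of the coefficients, with weight -/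
def acv (s : ℝ) (x y z : XX) (n : ZZ3) : ℝ≥0∞ :=
  ENNReal.ofReal (jb n ^ s) * cv (fun n => ‖ja s x n‖ₑ) (fun n => ‖ja s y n‖ₑ) (fun n => ‖ja s z n‖ₑ) n

/-- the constant -/
def cK (s : ℝ) : ℝ≥0 := (Real.toNNReal (3^s))^2 * 4 * (40 * 27^2)

lemma sq2_acv (s : ℝ) (hs : 0 ≤ s) (x y z : XX) :
    sq2 (acv s x y z) ≤ cK s * (‖x‖ₑ^2 * ‖DD s hs y‖ₑ^2 * ‖DD s hs z‖ₑ^2 +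
      ‖DD s hs x‖ₑ^2 * ‖y‖ₑ^2 * ‖DD s hs z‖ₑ^2 + ‖DD s hs x‖ₑ^2 * ‖DD s hs y‖ₑ^2 * ‖z‖ₑ^2) := by
  let A : XX → ZZ3 → ℝ≥0∞ := fun x n => jw n * ‖x n‖ₑ
  have hp : ∀ n, acv s x y z n ≤ ENNReal.ofReal (3^s) *
      ((cv (A x) (A (DD s hs y)) (A (DD s hs z)) n + cv (A (DD s hs x)) (A y) (A (DD s hs z)) n)
        + cv (A (DD s hs x)) (A (DD s hs y)) (A z) n) := by
    intro n
    rw [acv, cv, cv, cv, cv, ← ENNReal.tsum_mul_left, ← ENNReal.tsum_add, ← ENNReal.tsum_add,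
      ← ENNReal.tsum_mul_left]
    refine ENNReal.tsum_le_tsum fun p => ?_
    have h := ENNReal.ofReal_le_ofReal (jb_pow_le s hs n p.1 p.2)
    have h1 := Real.rpow_nonneg (jb_pos p.1).le s
    have h2 := Real.rpow_nonneg (jb_pos p.2).le s
    have h3 := Real.rpow_nonneg (jb_pos (n-p.1-p.2)).le s
    rw [ENNReal.ofReal_mul (by positivity), ENNReal.ofReal_add (by positivity) (by positivity),
      ENNReal.ofReal_add (by positivity) (by positivity)] at h
    refine (mul_le_mul' h le_rfl).trans (le_of_eq ?_)
    simp only [A]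
    generalize n - p.1 - p.2 = l
    rw [← enorm_ja' s hs x p.1, ← enorm_ja' s hs y p.2, ← enorm_ja' s hs z l,
      ← enorm_ja s hs, ← enorm_ja s hs, ← enorm_ja s hs]
    ring
  have hcv : ∀ x y z : XX, sq2 (cv (A x) (A y) (A z)) ≤ (40 * 27^2) * (‖x‖ₑ^2 * ‖y‖ₑ^2 * ‖z‖ₑ^2) := by
    intro x y z
    rw [← sq2_eq, ← sq2_eq, ← sq2_eq]
    exact cv_sq _ _ _
  have hc : ((cK s : ℝ≥0) : ℝ≥0∞) = ENNReal.ofReal (3^s) ^ 2 * 4 * (40 * 27^2) := by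
    rw [cK]; push_cast; rfl
  rw [hc]
  calc sq2 (acv s x y z) ≤ ∑' n, (ENNReal.ofReal (3^s))^2 * (((cv (A x) (A (DD s hs y)) (A (DD s hs z)) n + cv (A (DD s hs x)) (A y) (A (DD s hs z)) n)
        + cv (A (DD s hs x)) (A (DD s hs y)) (A z) n))^2 := by
        refine ENNReal.tsum_le_tsum fun n => ?_
        rw [← mul_pow]
        gcongr
        exact hp n
    _ ≤ (ENNReal.ofReal (3^s))^2 * (2 * (2 * ((40 * 27^2) * (‖x‖ₑ^2 * ‖DD s hs y‖ₑ^2 * ‖DD s hs z‖ₑ^2) +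
      (40 * 27^2) * (‖DD s hs x‖ₑ^2 * ‖y‖ₑ^2 * ‖DD s hs z‖ₑ^2)) + 2 * ((40 * 27^2) * (‖DD s hs x‖ₑ^2 * ‖DD s hs y‖ₑ^2 * ‖z‖ₑ^2)))) := by
        rw [ENNReal.tsum_mul_left]
        gcongr
        refine (enn_tsum_add_sq _ _).trans ?_
        gcongr
        · refine (enn_tsum_add_sq _ _).trans ?_
          gcongr
          · exact hcv _ _ _
          · exact hcv _ _ _
        · refine (hcv (DD s hs x) (DD s hs y) z).trans ?_
          exact le_mul_of_one_le_left' (by norm_num)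
    _ = _ := by ring

lemma acv_lt (s : ℝ) (hs : 0 ≤ s) (x y z : XX) : sq2 (acv s x y z) < ⊤ := by
  refine (sq2_acv s hs x y z).trans_lt ?_
  have h : ∀ x : XX, ‖x‖ₑ ^ 2 < ⊤ := fun x => ENNReal.pow_lt_top enorm_lt_top
  refine ENNReal.mul_lt_top ENNReal.coe_lt_top ?_
  simp only [ENNReal.add_lt_top]
  refine ⟨⟨?_, ?_⟩, ?_⟩ <;> exact ENNReal.mul_lt_top (ENNReal.mul_lt_top (h _) (h _)) (h _)

lemma summable_conv (s : ℝ) (hs : 0 ≤ s) (x y z : XX) (n : ZZ3) :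
    Summable (fun p : ZZ3 × ZZ3 => ‖ja s x p.1 * ja s y p.2 * ja s z (n - p.1 - p.2)‖) := by
  have h1 : (acv s x y z n)^2 < ⊤ := (ENNReal.le_tsum n).trans_lt (acv_lt s hs x y z)
  have h2 : acv s x y z n ≠ ⊤ := by
    intro h; rw [h] at h1; simp at h1
  have h3 : cv (fun n => ‖ja s x n‖ₑ) (fun n => ‖ja s y n‖ₑ) (fun n => ‖ja s z n‖ₑ) n ≠ ⊤ := by
    intro h
    rw [acv, h, ENNReal.mul_top] at h2
    · exact h2 rfl
    · have := Real.rpow_pos_of_pos (jb_pos n) s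
      simpa using this
  have := ENNReal.summable_toReal h3
  refine this.congr fun p => ?_
  simp [ENNReal.toReal_mul]

lemma enorm_conv_le (s : ℝ) (x y z : XX) (n : ZZ3) :
    ‖((jb n ^ s : ℝ) : ℂ) * conv3 (ja s x) (ja s y) (ja s z) n‖ₑ ≤ acv s x y z n := by
  have := Real.rpow_nonneg (jb_pos n).le s
  rw [acv, enorm_mul]
  refine mul_le_mul' (le_of_eq ?_) ?_
  · rw [← ofReal_norm, Complex.norm_real, Real.norm_of_nonneg this]
  · refine enorm_tsum_le_tsum_enorm.trans (le_of_eq ?_)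
    simp only [enorm_mul]; rfl

/-- The trilinear map -/
def TT (s : ℝ) (hs : 0 ≤ s) (x y z : XX) : XX :=
  ⟨fun n => ((jb n ^ s : ℝ) : ℂ) * conv3 (ja s x) (ja s y) (ja s z) n, memX (by
    refine ne_of_lt (lt_of_le_of_lt ?_ (acv_lt s hs x y z))
    refine ENNReal.tsum_le_tsum fun n => ?_
    gcongr
    exact enorm_conv_le s x y z n)⟩

lemma TT_apply (s : ℝ) (hs : 0 ≤ s) (x y z : XX) (n : ZZ3) :
    TT s hs x y z n = ((jb n ^ s : ℝ) : ℂ) * conv3 (ja s x) (ja s y) (ja s z) n := rfl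

/-- real constant -/
def cR (s : ℝ) : ℝ := Real.sqrt (cK s)

lemma cR_nonneg (s : ℝ) : 0 ≤ cR s := Real.sqrt_nonneg _

lemma TT_norm (s : ℝ) (hs : 0 ≤ s) (x y z : XX) :
    ‖TT s hs x y z‖ ≤ cR s * (‖x‖ * ‖DD s hs y‖ * ‖DD s hs z‖ +
      ‖DD s hs x‖ * ‖y‖ * ‖DD s hs z‖ + ‖DD s hs x‖ * ‖DD s hs y‖ * ‖z‖) := by
  have h : ‖TT s hs x y z‖ₑ^2 ≤ cK s * (‖x‖ₑ^2 * ‖DD s hs y‖ₑ^2 * ‖DD s hs z‖ₑ^2 +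
      ‖DD s hs x‖ₑ^2 * ‖y‖ₑ^2 * ‖DD s hs z‖ₑ^2 + ‖DD s hs x‖ₑ^2 * ‖DD s hs y‖ₑ^2 * ‖z‖ₑ^2) := by
    rw [← sq2_eq (TT s hs x y z)]
    refine le_trans ?_ (sq2_acv s hs x y z)
    refine ENNReal.tsum_le_tsum fun n => ?_
    gcongr
    exact enorm_conv_le s x y z n
  have h2 : ‖TT s hs x y z‖^2 ≤ cK s * (‖x‖^2 * ‖DD s hs y‖^2 * ‖DD s hs z‖^2 +
      ‖DD s hs x‖^2 * ‖y‖^2 * ‖DD s hs z‖^2 + ‖DD s hs x‖^2 * ‖DD s hs y‖^2 * ‖z‖^2) := by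
    simp only [enorm_eq_nnnorm] at h
    have h' : ‖TT s hs x y z‖₊^2 ≤ cK s * (‖x‖₊^2 * ‖DD s hs y‖₊^2 * ‖DD s hs z‖₊^2 +
      ‖DD s hs x‖₊^2 * ‖y‖₊^2 * ‖DD s hs z‖₊^2 + ‖DD s hs x‖₊^2 * ‖DD s hs y‖₊^2 * ‖z‖₊^2) := by
      exact_mod_cast h
    exact_mod_cast h'
  have hx := norm_nonneg x
  have hy := norm_nonneg y
  have hz := norm_nonneg z
  have hx' := norm_nonneg (DD s hs x)
  have hy' := norm_nonneg (DD s hs y)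
  have hz' := norm_nonneg (DD s hs z)
  have hc := cR_nonneg s
  have hcc : cR s ^ 2 = cK s := Real.sq_sqrt (by positivity)
  apply le_of_sq_le_sq _ (by positivity)
  refine h2.trans ?_
  rw [mul_pow, hcc]
  gcongr
  have p1 : 0 ≤ ‖x‖ * ‖DD s hs y‖ * ‖DD s hs z‖ := by positivity
  have p2 : 0 ≤ ‖DD s hs x‖ * ‖y‖ * ‖DD s hs z‖ := by positivity
  have p3 : 0 ≤ ‖DD s hs x‖ * ‖DD s hs y‖ * ‖z‖ := by positivity
  nlinarith [mul_nonneg p1 p2, mul_nonneg p1 p3, mul_nonneg p2 p3]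

lemma ja_sub (s : ℝ) (x y : XX) (n : ZZ3) : ja s (x - y) n = ja s x n - ja s y n := by
  simp [ja, mul_sub]

lemma TT_sub1 (s : ℝ) (hs : 0 ≤ s) (x x' y z : XX) :
    TT s hs (x - x') y z = TT s hs x y z - TT s hs x' y z := by
  apply lp.ext; funext n
  simp only [lp.coeFn_sub, Pi.sub_apply, TT_apply]
  rw [← mul_sub, conv3, conv3, conv3,
    ← (summable_conv s hs x y z n).of_norm.tsum_sub (summable_conv s hs x' y z n).of_norm]
  congr 1
  apply tsum_congr; intro p; rw [ja_sub]; ring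

lemma TT_sub2 (s : ℝ) (hs : 0 ≤ s) (x y y' z : XX) :
    TT s hs x (y - y') z = TT s hs x y z - TT s hs x y' z := by
  apply lp.ext; funext n
  simp only [lp.coeFn_sub, Pi.sub_apply, TT_apply]
  rw [← mul_sub, conv3, conv3, conv3,
    ← (summable_conv s hs x y z n).of_norm.tsum_sub (summable_conv s hs x y' z n).of_norm]
  congr 1
  apply tsum_congr; intro p; rw [ja_sub]; ring

lemma TT_sub3 (s : ℝ) (hs : 0 ≤ s) (x y z z' : XX) :
    TT s hs x y (z - z') = TT s hs x y z - TT s hs x y z' := by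
  apply lp.ext; funext n
  simp only [lp.coeFn_sub, Pi.sub_apply, TT_apply]
  rw [← mul_sub, conv3, conv3, conv3,
    ← (summable_conv s hs x y z n).of_norm.tsum_sub (summable_conv s hs x y z' n).of_norm]
  congr 1
  apply tsum_congr; intro p; rw [ja_sub]; ring

lemma conv3_sw12 (f g h : ZZ3 → ℂ) (n : ZZ3) : conv3 f g h n = conv3 g f h n := by
  rw [conv3, tsum_sw12 n (fun m k l => f m * g k * h l)]
  apply tsum_congr; intro p; ring

lemma conv3_sw23 (f g h : ZZ3 → ℂ) (n : ZZ3) : conv3 f g h n = conv3 f h g n := by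
  rw [conv3, tsum_sw23 n (fun m k l => f m * g k * h l)]
  apply tsum_congr; intro p; ring

lemma TT_sw12 (s : ℝ) (hs : 0 ≤ s) (x y z : XX) : TT s hs x y z = TT s hs y x z := by
  apply lp.ext; funext n
  rw [TT_apply, TT_apply, conv3_sw12]

lemma TT_sw23 (s : ℝ) (hs : 0 ≤ s) (x y z : XX) : TT s hs x y z = TT s hs x z y := by
  apply lp.ext; funext n
  rw [TT_apply, TT_apply, conv3_sw23]

/-- crude bound -/
lemma TT_norm' (s : ℝ) (hs : 0 ≤ s) (x y z : XX) :
    ‖TT s hs x y z‖ ≤ 3 * cR s * (‖x‖ * ‖y‖ * ‖z‖) := by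
  refine (TT_norm s hs x y z).trans ?_
  have hc := cR_nonneg s
  have : ‖x‖ * ‖DD s hs y‖ * ‖DD s hs z‖ +
      ‖DD s hs x‖ * ‖y‖ * ‖DD s hs z‖ + ‖DD s hs x‖ * ‖DD s hs y‖ * ‖z‖ ≤
      ‖x‖ * ‖y‖ * ‖z‖ + ‖x‖ * ‖y‖ * ‖z‖ + ‖x‖ * ‖y‖ * ‖z‖ := by
    gcongr <;> exact DD_norm_le s hs _
  calc _ ≤ cR s * (‖x‖ * ‖y‖ * ‖z‖ + ‖x‖ * ‖y‖ * ‖z‖ + ‖x‖ * ‖y‖ * ‖z‖) := by gcongr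
    _ = _ := by ring

lemma CX_mem (x : XX) : sq2 (fun n => ‖(starRingEnd ℂ) (x (-n))‖ₑ) = ‖x‖ₑ ^ 2 := by
  rw [← sq2_eq x, sq2, sq2, ← (Equiv.neg ZZ3).tsum_eq (fun n => ‖x n‖ₑ ^ 2)]
  apply tsum_congr; intro n
  simp [← ofReal_norm]

/-- `(Cx) n = conj (x (-n))` -/
def CX : XX →L[ℝ] XX :=
  LinearMap.mkContinuous
    { toFun := fun x => ⟨fun n => (starRingEnd ℂ) (x (-n)), memX (by
        rw [CX_mem]; exact (ENNReal.pow_lt_top enorm_lt_top).ne)⟩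
      map_add' := fun x y => by
        apply lp.ext; funext n
        exact map_add (starRingEnd ℂ) (x (-n)) (y (-n))
      map_smul' := fun c x => by
        apply lp.ext; funext n
        simp } 1 (by
      intro x
      rw [one_mul]
      apply le_of_eq
      have h := sq2_eq (⟨fun n => (starRingEnd ℂ) (x (-n)), memX (by
        rw [CX_mem]; exact (ENNReal.pow_lt_top enorm_lt_top).ne)⟩ : XX)
      have h2 := h.symm.trans (CX_mem x)
      have h3 := (ENNReal.pow_right_strictMono (n := 2) two_ne_zero).injective h2
      have h4 := congrArg ENNReal.toReal h3
      simpa using h4)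

lemma CX_apply (x : XX) (n : ZZ3) : CX x n = (starRingEnd ℂ) (x (-n)) := rfl

lemma CX_norm_le (x : XX) : ‖CX x‖ ≤ ‖x‖ := by
  have := (CX.le_opNorm x)
  refine this.trans (mul_le_of_le_one_left (norm_nonneg _) ?_)
  exact LinearMap.mkContinuous_norm_le _ zero_le_one _

/-- Hermitian part -/
def RX : XX →L[ℝ] XX := (1/2 : ℝ) • (ContinuousLinearMap.id ℝ XX + CX)

lemma RX_apply (x : XX) (n : ZZ3) : RX x n = (x n + (starRingEnd ℂ) (x (-n))) / 2 := by
  have : RX x n = (1/2:ℝ) • (x n + CX x n) := rfl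
  rw [this, CX_apply, Complex.real_smul]; push_cast; ring

lemma RX_norm_le (x : XX) : ‖RX x‖ ≤ ‖x‖ := by
  have : RX x = (1/2:ℝ) • (x + CX x) := rfl
  rw [this, norm_smul]
  have := norm_add_le x (CX x)
  have := CX_norm_le x
  norm_num; linarith

lemma RX_herm (x : XX) : HermSymm (RX x) := by
  intro n
  have h2 : (starRingEnd ℂ) (2:ℂ) = 2 := Complex.conj_ofNat 2
  rw [RX_apply, RX_apply, map_div₀, map_add, Complex.conj_conj, neg_neg, h2, add_comm]

lemma RX_of_herm (x : XX) (hx : HermSymm x) : RX x = x := by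
  apply lp.ext; funext n
  rw [RX_apply, hx n]; simp

/-- multiplication by i -/
def IX : XX →L[ℝ] XX := mulX (fun _ => Complex.I) (by simp)
lemma IX_apply (x : XX) (n : ZZ3) : IX x n = Complex.I * x n := rfl

/-- half-wave propagator -/
def VX (t : ℝ) : XX →L[ℝ] XX := mulX (fun n => Complex.exp (((t * jb n : ℝ) : ℂ) * Complex.I))
  (fun n => by rw [Complex.norm_exp_ofReal_mul_I])
lemma VX_apply (t : ℝ) (x : XX) (n : ZZ3) :
  VX t x n = Complex.exp (((t * jb n : ℝ) : ℂ) * Complex.I) * x n := rfl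

lemma VX_norm_le (t : ℝ) (x : XX) : ‖VX t x‖ ≤ ‖x‖ := mulX_norm_le _ _ _
lemma IX_norm_le (x : XX) : ‖IX x‖ ≤ ‖x‖ := mulX_norm_le _ _ _

lemma VX_neg (t : ℝ) (x : XX) : VX t (VX (-t) x) = x := by
  apply lp.ext; funext n
  rw [VX_apply, VX_apply, ← mul_assoc, ← Complex.exp_add]
  simp

lemma VX_neg' (t : ℝ) (x : XX) : VX (-t) (VX t x) = x := by
  have := VX_neg (-t) x
  rwa [neg_neg] at this

lemma VX_norm (t : ℝ) (x : XX) : ‖VX t x‖ = ‖x‖ := by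
  apply le_antisymm (VX_norm_le t x)
  conv_lhs => rw [← VX_neg' t x]
  exact VX_norm_le _ _

lemma VX_zero (x : XX) : VX 0 x = x := by
  apply lp.ext; funext n
  rw [VX_apply]; simp

lemma normX_sq (x : XX) : ‖x‖ ^ 2 = ∑' n, ‖x n‖ ^ 2 := by
  have h := (lp.hasSum_norm two_toReal_pos x).tsum_eq
  simp only [ENNReal.toReal_ofNat, Real.rpow_ofNat] at h
  exact h.symm

lemma summable_normX_sq (x : XX) : Summable fun n => ‖x n‖ ^ 2 := by
  have h := (lp.hasSum_norm two_toReal_pos x).summable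
  simpa only [ENNReal.toReal_ofNat, Real.rpow_ofNat] using h

lemma VX_cont (x : XX) : Continuous fun t => VX t x := by
  rw [continuous_iff_continuousAt]
  intro t₀
  rw [ContinuousAt, tendsto_iff_norm_sub_tendsto_zero]
  have h : Filter.Tendsto (fun t => ‖VX t x - VX t₀ x‖ ^ 2) (nhds t₀) (nhds 0) := by
    simp only [normX_sq]
    have h0 : (∑' n : ZZ3, (0:ℝ)) = 0 := tsum_zero
    rw [← h0]
    apply tendsto_tsum_of_dominated_convergence (bound := fun n => 4 * ‖x n‖ ^ 2)
      ((summable_normX_sq x).mul_left 4)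
    · intro n
      have : Continuous fun t => ‖(VX t x - VX t₀ x) n‖ ^ 2 := by
        simp only [lp.coeFn_sub, Pi.sub_apply, VX_apply]
        fun_prop
      have h2 := this.tendsto t₀
      simpa using h2
    · refine Filter.Eventually.of_forall fun t n => ?_
      simp only [lp.coeFn_sub, Pi.sub_apply, norm_pow, norm_norm]
      have h1 : ∀ t, ‖VX t x n‖ = ‖x n‖ := fun t => by
        rw [VX_apply, norm_mul, Complex.norm_exp_ofReal_mul_I, one_mul]
      have h2 := norm_sub_le (VX t x n) (VX t₀ x n)
      rw [h1, h1] at h2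
      have h3 := norm_nonneg (VX t x n - VX t₀ x n)
      nlinarith
  have h2 := h.sqrt
  simpa using h2

lemma VX_cont2 : Continuous fun p : ℝ × XX => VX p.1 p.2 := by
  rw [continuous_iff_continuousAt]
  rintro ⟨t, x⟩
  rw [ContinuousAt, tendsto_iff_norm_sub_tendsto_zero]
  have h1 : Continuous fun p : ℝ × XX => ‖p.2 - x‖ + ‖VX p.1 x - VX t x‖ :=
    (continuous_snd.sub continuous_const).norm.add
      (((VX_cont x).comp continuous_fst).sub continuous_const).norm
  have h2 := h1.tendsto (t, x)
  simp only [sub_self, norm_zero, add_zero] at h2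
  refine squeeze_zero (fun _ => norm_nonneg _) (fun p => ?_) h2
  have e : VX p.1 p.2 - VX t x = VX p.1 (p.2 - x) + (VX p.1 x - VX t x) := by
    rw [map_sub]; abel
  rw [e]
  refine (norm_add_le _ _).trans ?_
  gcongr
  exact VX_norm_le _ _

lemma TT_zero (s : ℝ) (hs : 0 ≤ s) (x y : XX) : TT s hs 0 x y = 0 := by
  have := TT_sub1 s hs 0 0 x y
  simpa using this

/-- the nonlinearity -/
def FF (s : ℝ) (hs : 0 ≤ s) (z : XX) : XX :=
  DD 1 zero_le_one (RX z) - TT s hs (RX z) (RX z) (RX z)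

/-- Lipschitz constant on balls -/
def lipF (s M : ℝ) : ℝ := 1 + 9 * cR s * M ^ 2

lemma lipF_nonneg (s M : ℝ) : 0 ≤ lipF s M := by
  have := cR_nonneg s
  rw [lipF]; positivity

lemma FF_lip (s : ℝ) (hs : 0 ≤ s) (M : ℝ) (x y : XX) (hx : ‖x‖ ≤ M) (hy : ‖y‖ ≤ M) :
    ‖FF s hs x - FF s hs y‖ ≤ lipF s M * ‖x - y‖ := by
  have hM : 0 ≤ M := (norm_nonneg _).trans hx
  have hc := cR_nonneg s
  have e : FF s hs x - FF s hs y = DD 1 zero_le_one (RX (x - y)) -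
     (TT s hs (RX (x - y)) (RX x) (RX x) + TT s hs (RX y) (RX (x-y)) (RX x)
      + TT s hs (RX y) (RX y) (RX (x-y))) := by
    rw [FF, FF, map_sub RX, map_sub (DD 1 _), TT_sub1, TT_sub2, TT_sub3]; abel
  have hd : ‖RX (x - y)‖ ≤ ‖x - y‖ := RX_norm_le _
  have hx' : ‖RX x‖ ≤ M := (RX_norm_le x).trans hx
  have hy' : ‖RX y‖ ≤ M := (RX_norm_le y).trans hy
  have h1 : ‖TT s hs (RX (x - y)) (RX x) (RX x)‖ ≤ 3 * cR s * (‖x - y‖ * M * M) :=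
    (TT_norm' s hs _ _ _).trans (by gcongr)
  have h2 : ‖TT s hs (RX y) (RX (x-y)) (RX x)‖ ≤ 3 * cR s * (M * ‖x - y‖ * M) :=
    (TT_norm' s hs _ _ _).trans (by gcongr)
  have h3 : ‖TT s hs (RX y) (RX y) (RX (x-y))‖ ≤ 3 * cR s * (M * M * ‖x - y‖) :=
    (TT_norm' s hs _ _ _).trans (by gcongr)
  have h4 : ‖DD 1 zero_le_one (RX (x - y))‖ ≤ ‖x - y‖ := (DD_norm_le _ _ _).trans hd
  rw [e]
  refine (norm_sub_le _ _).trans ?_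
  have h5 := norm_add₃_le (a := TT s hs (RX (x - y)) (RX x) (RX x)) (b := TT s hs (RX y) (RX (x-y)) (RX x))
      (c := TT s hs (RX y) (RX y) (RX (x-y)))
  rw [lipF]; linarith

lemma FF_zero (s : ℝ) (hs : 0 ≤ s) : FF s hs 0 = 0 := by
  rw [FF]; simp [TT_zero]

lemma FF_cont (s : ℝ) (hs : 0 ≤ s) : Continuous (FF s hs) := by
  rw [continuous_iff_continuousAt]
  intro x
  have h : ContinuousOn (FF s hs) (Metric.ball 0 (‖x‖ + 1)) := by
    have : LipschitzOnWith (Real.toNNReal (lipF s (‖x‖+1))) (FF s hs) (Metric.ball 0 (‖x‖+1)) := by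
      apply LipschitzOnWith.of_dist_le_mul
      intro a ha b hb
      rw [mem_ball_zero_iff] at ha hb
      rw [dist_eq_norm, dist_eq_norm, Real.coe_toNNReal _ (lipF_nonneg _ _)]
      exact FF_lip s hs _ a b ha.le hb.le
    exact this.continuousOn
  exact h.continuousAt (Metric.isOpen_ball.mem_nhds (by simp))

/-- vector field in the interaction picture -/
def GG (s : ℝ) (hs : 0 ≤ s) (t : ℝ) (w : XX) : XX := IX (VX t (FF s hs (VX (-t) w)))

lemma GG_cont (s : ℝ) (hs : 0 ≤ s) : Continuous fun p : ℝ × XX => GG s hs p.1 p.2 := by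
  have h1 : Continuous fun p : ℝ × XX => VX (-p.1) p.2 :=
    VX_cont2.comp (continuous_fst.neg.prodMk continuous_snd)
  have h2 : Continuous fun p : ℝ × XX => FF s hs (VX (-p.1) p.2) := (FF_cont s hs).comp h1
  exact IX.continuous.comp (VX_cont2.comp (continuous_fst.prodMk h2))

lemma GG_lip (s : ℝ) (hs : 0 ≤ s) (M t : ℝ) (x y : XX) (hx : ‖x‖ ≤ M) (hy : ‖y‖ ≤ M) :
    ‖GG s hs t x - GG s hs t y‖ ≤ lipF s M * ‖x - y‖ := by
  rw [GG, GG, ← map_sub, ← map_sub]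
  refine (IX_norm_le _).trans ((VX_norm_le _ _).trans ?_)
  refine (FF_lip s hs M _ _ ?_ ?_).trans ?_
  · rwa [VX_norm]
  · rwa [VX_norm]
  · rw [← map_sub, VX_norm]

lemma GG_bdd (s : ℝ) (hs : 0 ≤ s) (M t : ℝ) (x : XX) (hx : ‖x‖ ≤ M) :
    ‖GG s hs t x‖ ≤ lipF s M * M := by
  have h0 : GG s hs t 0 = 0 := by rw [GG]; simp [FF_zero]
  have := GG_lip s hs M t x 0 hx (by simpa using (norm_nonneg _).trans hx)
  rw [h0, sub_zero, sub_zero] at this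
  exact this.trans (by gcongr; exact lipF_nonneg _ _)

section ode
open Set
variable {E : Type*} [NormedAddCommGroup E] [NormedSpace ℝ E]

/-- radial cutoff -/
def cutP (M : ℝ) (x : E) : E := (M / max M ‖x‖) • x

lemma cutP_norm (M : ℝ) (hM : 0 < M) (x : E) : ‖cutP M x‖ ≤ M := by
  have h : 0 < max M ‖x‖ := lt_max_of_lt_left hM
  rw [cutP, norm_smul, Real.norm_of_nonneg (by positivity), div_mul_eq_mul_div, div_le_iff₀ h]
  gcongr; exact le_max_right _ _

lemma cutP_eq (M : ℝ) (hM : 0 < M) (x : E) (hx : ‖x‖ ≤ M) : cutP M x = x := by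
  rw [cutP, max_eq_left hx, div_self hM.ne', one_smul]

lemma cutP_lip (M : ℝ) (hM : 0 < M) (x y : E) : ‖cutP M x - cutP M y‖ ≤ 2 * ‖x - y‖ := by
  have hx : 0 < max M ‖x‖ := lt_max_of_lt_left hM
  have hy : 0 < max M ‖y‖ := lt_max_of_lt_left hM
  have e : cutP M x - cutP M y = (M / max M ‖x‖) • (x - y) + (M / max M ‖x‖ - M / max M ‖y‖) • y := by
    rw [cutP, cutP, smul_sub, sub_smul]; abel
  have h1 : ‖(M / max M ‖x‖) • (x - y)‖ ≤ ‖x - y‖ := by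
    rw [norm_smul, Real.norm_of_nonneg (by positivity)]
    exact mul_le_of_le_one_left (norm_nonneg _) ((div_le_one hx).2 (le_max_left _ _))
  have h2 : ‖(M / max M ‖x‖ - M / max M ‖y‖) • y‖ ≤ ‖x - y‖ := by
    have e2 : M / max M ‖x‖ - M / max M ‖y‖ = (M / max M ‖x‖) * (max M ‖y‖ - max M ‖x‖) / max M ‖y‖ := by
      field_simp
    rw [norm_smul, e2, Real.norm_eq_abs, abs_div, abs_mul, abs_of_pos hy, abs_of_pos (by positivity : 0 < M / max M ‖x‖)]
    have h3 : |max M ‖y‖ - max M ‖x‖| ≤ ‖x - y‖ := by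
      refine (abs_max_sub_max_le_max M ‖y‖ M ‖x‖).trans ?_
      simp only [sub_self, abs_zero]
      refine max_le (norm_nonneg _) ?_
      rw [norm_sub_rev]
      exact abs_norm_sub_norm_le y x
    calc M / max M ‖x‖ * |max M ‖y‖ - max M ‖x‖| / max M ‖y‖ * ‖y‖ 
        = M / max M ‖x‖ * (|max M ‖y‖ - max M ‖x‖| * (‖y‖ / max M ‖y‖)) := by ring
      _ ≤ 1 * (‖x - y‖ * 1) := by
        gcongr
        · exact (div_le_one hx).2 (le_max_left _ _)
        · exact (div_le_one hy).2 (le_max_right _ _)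
      _ = _ := by ring
  rw [e]
  refine (norm_add_le _ _).trans ?_
  linarith

variable (G : ℝ → E → E) (L : ℝ → ℝ)

lemma ode_unique (hL : ∀ M, 0 ≤ L M)
    (lip : ∀ M t x y, ‖x‖ ≤ M → ‖y‖ ≤ M → ‖G t x - G t y‖ ≤ L M * ‖x - y‖)
    (T : ℝ) (hT : 0 < T) (w v : ℝ → E)
    (hw : ContinuousOn w (Icc (-T) T)) (hv : ContinuousOn v (Icc (-T) T))
    (hw' : ∀ t ∈ Ioo (-T) T, HasDerivAt w (G t (w t)) t)
    (hv' : ∀ t ∈ Ioo (-T) T, HasDerivAt v (G t (v t)) t) (h0 : w 0 = v 0) :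
    EqOn w v (Icc (-T) T) := by
  obtain ⟨M1, h1⟩ := isCompact_Icc.exists_bound_of_continuousOn hw
  obtain ⟨M2, h2⟩ := isCompact_Icc.exists_bound_of_continuousOn hv
  set M := max M1 M2
  have hlip : ∀ t ∈ Ioo (-T) T, LipschitzOnWith (Real.toNNReal (L M)) (G t) (Metric.closedBall 0 M) := by
    intro t ht
    apply LipschitzOnWith.of_dist_le_mul
    intro a ha b hb
    rw [mem_closedBall_zero_iff] at ha hb
    rw [dist_eq_norm, dist_eq_norm, Real.coe_toNNReal _ (hL _)]
    exact lip _ _ _ _ ha hb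
  exact ODE_solution_unique_of_mem_Icc (s := fun _ => Metric.closedBall 0 M) hlip
    (show (0:ℝ) ∈ Ioo (-T) T by constructor <;> linarith) hw hw'
    (fun t ht => mem_closedBall_zero_iff.2 ((h1 t (Ioo_subset_Icc_self ht)).trans (le_max_left _ _)))
    hv hv'
    (fun t ht => mem_closedBall_zero_iff.2 ((h2 t (Ioo_subset_Icc_self ht)).trans (le_max_right _ _)))
    h0

lemma ode_local [CompleteSpace E] (hL : ∀ M, 0 ≤ L M)
    (hc : ∀ x, Continuous fun t => G t x)
    (lip : ∀ M t x y, ‖x‖ ≤ M → ‖y‖ ≤ M → ‖G t x - G t y‖ ≤ L M * ‖x - y‖)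
    (bdd : ∀ M t x, ‖x‖ ≤ M → ‖G t x‖ ≤ L M * M) (x₀ : E) (T : ℝ) (hT : 0 < T) (B : ℝ)
    (ap : ∀ T', 0 < T' → T' ≤ T → ∀ w : ℝ → E, ContinuousOn w (Icc (-T') T') →
      (∀ t ∈ Ioo (-T') T', HasDerivAt w (G t (w t)) t) → w 0 = x₀ → ∀ t ∈ Icc (-T') T', ‖w t‖ ≤ B) :
    ∃ w : ℝ → E, w 0 = x₀ ∧ ContinuousOn w (Icc (-T) T) ∧
      ∀ t ∈ Ioo (-T) T, HasDerivAt w (G t (w t)) t := by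
  set M := max B ‖x₀‖ + 1 with hMd
  have hMB : B < M := lt_of_le_of_lt (le_max_left _ _) (lt_add_one _)
  have hMx : ‖x₀‖ < M := lt_of_le_of_lt (le_max_right _ _) (lt_add_one _)
  have hM : 0 < M := (norm_nonneg _).trans_lt hMx
  have h0 : (0:ℝ) ∈ Icc (-T) T := by constructor <;> linarith
  have hPL : IsPicardLindelof (fun t x => G t (cutP M x)) (⟨0, h0⟩ : Icc (-T) T) x₀
      (Real.toNNReal (L M * M * T)) 0 (Real.toNNReal (L M * M)) (Real.toNNReal (L M * 2)) := by
    have := hL M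
    refine ⟨?_, ?_, ?_, ?_⟩
    · intro t ht
      apply LipschitzOnWith.of_dist_le_mul
      intro a ha b hb
      rw [dist_eq_norm, dist_eq_norm, Real.coe_toNNReal _ (by positivity)]
      refine (lip M t _ _ (cutP_norm M hM a) (cutP_norm M hM b)).trans ?_
      rw [mul_assoc]
      gcongr
      exact cutP_lip M hM a b
    · intro x _
      exact (hc _).continuousOn
    · intro t _ x _
      rw [Real.coe_toNNReal _ (by positivity)]
      exact bdd M t _ (cutP_norm M hM x)
    · rw [Real.coe_toNNReal _ (by positivity), Real.coe_toNNReal _ (by positivity)]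
      simp
  obtain ⟨w, hw0, hw⟩ := hPL.exists_eq_forall_mem_Icc_hasDerivWithinAt₀
  change w 0 = x₀ at hw0
  have hwc : ContinuousOn w (Icc (-T) T) := fun t ht => (hw t ht).continuousWithinAt
  have hd : ∀ t ∈ Ioo (-T) T, ‖w t‖ ≤ M → HasDerivAt w (G t (w t)) t := by
    intro t ht h
    have := (hw t (Ioo_subset_Icc_self ht)).hasDerivAt (Icc_mem_nhds ht.1 ht.2)
    simpa only [cutP_eq M hM _ h] using this
  have key : ∀ t ∈ Icc (-T) T, ‖w t‖ < M := by
    by_contra! hcon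
    obtain ⟨t₁, ht₁, hM1⟩ := hcon
    have hcl : IsClosed (Icc (-T) T ∩ (fun t => ‖w t‖) ⁻¹' (Ici M)) :=
      hwc.norm.preimage_isClosed_of_isClosed isClosed_Icc isClosed_Ici
    have hcomp : IsCompact (Icc (-T) T ∩ (fun t => ‖w t‖) ⁻¹' (Ici M)) :=
      isCompact_Icc.of_isClosed_subset hcl inter_subset_left
    obtain ⟨τ, ⟨hτ, hτM⟩, hmin⟩ := hcomp.exists_isMinOn ⟨t₁, ht₁, hM1⟩ (continuous_abs.continuousOn)
    have hτM' : M ≤ ‖w τ‖ := hτM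
    have hτ0 : τ ≠ 0 := by
      rintro rfl
      rw [hw0] at hτM'; linarith
    have hpos : 0 < |τ| := abs_pos.2 hτ0
    have hle : |τ| ≤ T := abs_le.2 hτ
    have hlt : ∀ t, |t| < |τ| → ‖w t‖ < M := by
      intro t ht
      by_contra! h
      have := hmin (show t ∈ Icc (-T) T ∩ (fun t => ‖w t‖) ⁻¹' (Ici M) from
        ⟨abs_le.1 (ht.le.trans hle), h⟩)
      simp only [mem_setOf_eq] at this
      linarith
    have := ap |τ| hpos hle w (hwc.mono (Icc_subset_Icc (by linarith) hle)) (fun t ht =>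
      hd t ⟨by linarith [ht.1], by linarith [ht.2]⟩ (hlt t (abs_lt.2 ht)).le) hw0 τ
      (abs_le.1 le_rfl)
    linarith
  exact ⟨w, hw0, hwc, fun t ht => hd t ht (key t (Ioo_subset_Icc_self ht)).le⟩

lemma ode_global [CompleteSpace E] (hL : ∀ M, 0 ≤ L M)
    (hc : ∀ x, Continuous fun t => G t x)
    (lip : ∀ M t x y, ‖x‖ ≤ M → ‖y‖ ≤ M → ‖G t x - G t y‖ ≤ L M * ‖x - y‖)
    (bdd : ∀ M t x, ‖x‖ ≤ M → ‖G t x‖ ≤ L M * M) (x₀ : E)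
    (ap : ∀ T, 0 < T → ∃ B : ℝ, ∀ T', 0 < T' → T' ≤ T → ∀ w : ℝ → E, ContinuousOn w (Icc (-T') T') →
      (∀ t ∈ Ioo (-T') T', HasDerivAt w (G t (w t)) t) → w 0 = x₀ → ∀ t ∈ Icc (-T') T', ‖w t‖ ≤ B) :
    ∃ w : ℝ → E, w 0 = x₀ ∧ ∀ t, HasDerivAt w (G t (w t)) t := by
  have hex : ∀ T : ℝ, ∃ w : ℝ → E, 0 < T → (w 0 = x₀ ∧ ContinuousOn w (Icc (-T) T) ∧
      ∀ t ∈ Ioo (-T) T, HasDerivAt w (G t (w t)) t) := by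
    intro T
    by_cases hT : 0 < T
    · obtain ⟨B, hB⟩ := ap T hT
      obtain ⟨w, hw⟩ := ode_local G L hL hc lip bdd x₀ T hT B hB
      exact ⟨w, fun _ => hw⟩
    · exact ⟨fun _ => 0, fun h => absurd h hT⟩
  choose w hw using hex
  have agree : ∀ T₁ T₂ t, 0 < T₁ → 0 < T₂ → |t| ≤ T₁ → |t| ≤ T₂ → w T₁ t = w T₂ t := by
    intro T₁ T₂ t h₁ h₂ ht₁ ht₂
    have hm : 0 < min T₁ T₂ := lt_min h₁ h₂
    have l1 := min_le_left T₁ T₂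
    have l2 := min_le_right T₁ T₂
    obtain ⟨a1, b1, c1⟩ := hw T₁ h₁
    obtain ⟨a2, b2, c2⟩ := hw T₂ h₂
    refine ode_unique G L hL lip (min T₁ T₂) hm (w T₁) (w T₂)
      (b1.mono (Icc_subset_Icc (by linarith) l1)) (b2.mono (Icc_subset_Icc (by linarith) l2))
      (fun t ht => c1 t ⟨by linarith [ht.1], by linarith [ht.2]⟩)
      (fun t ht => c2 t ⟨by linarith [ht.1], by linarith [ht.2]⟩) (a1.trans a2.symm)
      (abs_le.1 (le_min ht₁ ht₂))
  have hp : ∀ t : ℝ, 0 < |t| + 1 := fun t => by positivity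
  refine ⟨fun t => w (|t| + 1) t, ?_, ?_⟩
  · exact (hw _ (hp 0)).1
  · intro t
    have hd := (hw _ (hp t)).2.2 t (abs_lt.1 (lt_add_one _))
    refine hd.congr_of_eventuallyEq ?_
    have : ∀ᶠ u in nhds t, |u| < |t| + 1 :=
      continuous_abs.continuousAt.eventually_lt continuousAt_const (lt_add_one _)
    filter_upwards [this] with u hu
    exact agree _ _ _ (hp u) (hp t) (lt_add_one _).le hu.le

end ode

section comp
open Set Filter Topology

lemma coord_le (x : XX) (n : ZZ3) : ‖x n‖ ≤ ‖x‖ := lp.norm_apply_le_norm (by norm_num) x n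

/-- coordinate functional -/
def evX (n : ZZ3) : XX →L[ℝ] ℂ :=
  LinearMap.mkContinuous
    { toFun := fun x => x n
      map_add' := fun x y => rfl
      map_smul' := fun c x => rfl } 1 (by
      intro x; rw [one_mul]; exact coord_le x n)

lemma evX_apply (n : ZZ3) (x : XX) : evX n x = x n := rfl

lemma HasDerivAt.coord {w : ℝ → XX} {w' : XX} {t : ℝ} (h : HasDerivAt w w' t) (n : ZZ3) :
    HasDerivAt (fun u => w u n) (w' n) t :=
  (evX n).hasFDerivAt.comp_hasDerivAt t h

lemma comp_mvt (f g : ℝ → XX) (I : Set ℝ) (hI : Convex ℝ I) (c : XX) (ε : ℝ) (hε : 0 ≤ ε)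
    (hd : ∀ u ∈ I, ∀ n, HasDerivAt (fun u => f u n) (g u n) u) (hb : ∀ u ∈ I, ‖g u - c‖ ≤ ε)
    (u v : ℝ) (hu : u ∈ I) (hv : v ∈ I) : ‖f u - f v - (u - v) • c‖ ≤ ε * |u - v| := by
  apply lp.norm_le_of_forall_sum_le two_toReal_pos (by positivity)
  intro S
  simp only [ENNReal.toReal_ofNat, Real.rpow_ofNat]
  let L := (PiLp.continuousLinearEquiv 2 ℝ (fun _ : S => ℂ)).symm
  let φ : ℝ → EuclideanSpace ℂ S := fun u => L (fun n : S => f u n - u • c n)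
  have hφ : ∀ u ∈ I, HasDerivWithinAt φ (L (fun n : S => g u n - c n)) I u := by
    intro u hu
    apply HasDerivAt.hasDerivWithinAt
    apply L.hasFDerivAt.comp_hasDerivAt u
    rw [hasDerivAt_pi]
    intro n
    have h1 := (hasDerivAt_id u).smul_const (c n)
    rw [one_smul] at h1
    exact (hd u hu n).sub h1
  have hbd : ∀ u ∈ I, ‖L (fun n : S => g u n - c n)‖ ≤ ε := by
    intro u hu
    refine le_trans ?_ (hb u hu)
    rw [EuclideanSpace.norm_eq]
    apply Real.sqrt_le_iff.2 ⟨norm_nonneg _, ?_⟩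
    have := lp.sum_rpow_le_norm_rpow two_toReal_pos (g u - c) S
    simp only [ENNReal.toReal_ofNat, Real.rpow_ofNat] at this
    refine le_trans (le_of_eq ?_) this
    rw [← Finset.sum_coe_sort S]
    rfl
  have key := hI.norm_image_sub_le_of_norm_hasDerivWithin_le hφ hbd hv hu
  have h2 : ‖φ u - φ v‖ ^ 2 ≤ (ε * |u - v|) ^ 2 := by
    rw [Real.norm_eq_abs] at key; gcongr
  refine le_trans (le_of_eq ?_) h2
  rw [EuclideanSpace.norm_sq_eq, ← Finset.sum_coe_sort S]
  apply Finset.sum_congr rfl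
  intro n _
  congr 2
  change f u n - f v n - (u - v) • c n = (f u n - u • c n) - (f v n - v • c n)
  rw [sub_smul]; ring

lemma comp_hasDerivAt (f g : ℝ → XX) (t : ℝ)
    (hd : ∀ᶠ u in 𝓝 t, ∀ n, HasDerivAt (fun u => f u n) (g u n) u) (hg : ContinuousAt g t) :
    HasDerivAt f (g t) t := by
  rw [hasDerivAt_iff_isLittleO, Asymptotics.isLittleO_iff]
  intro ε hε
  have h1 : ∀ᶠ u in 𝓝 t, ‖g u - g t‖ < ε := by
    have := Metric.tendsto_nhds.1 hg ε hε
    simpa only [dist_eq_norm] using this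
  obtain ⟨δ, hδ, hball⟩ := Metric.eventually_nhds_iff_ball.1 (hd.and h1)
  filter_upwards [Metric.ball_mem_nhds t hδ] with u hu
  exact comp_mvt f g (Metric.ball t δ) (convex_ball _ _) (g t) ε hε.le (fun u hu => (hball u hu).1)
    (fun u hu => (hball u hu).2.le) u t hu (Metric.mem_ball_self hδ)

lemma comp_continuousAt (f g : ℝ → XX) (t C : ℝ)
    (hd : ∀ᶠ u in 𝓝 t, ∀ n, HasDerivAt (fun u => f u n) (g u n) u) 
    (hg : ∀ᶠ u in 𝓝 t, ‖g u‖ ≤ C) :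
    ContinuousAt f t := by
  obtain ⟨δ, hδ, hball⟩ := Metric.eventually_nhds_iff_ball.1 (hd.and hg)
  have hC : 0 ≤ C := (norm_nonneg _).trans (hball t (Metric.mem_ball_self hδ)).2
  rw [ContinuousAt, tendsto_iff_norm_sub_tendsto_zero]
  have h2 : Tendsto (fun u => C * |u - t|) (𝓝 t) (𝓝 0) := by
    have : Continuous fun u => C * |u - t| := by fun_prop
    simpa using this.tendsto t
  refine squeeze_zero' (Eventually.of_forall fun _ => norm_nonneg _) ?_ h2
  filter_upwards [Metric.ball_mem_nhds t hδ] with u hu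
  have := comp_mvt f g (Metric.ball t δ) (convex_ball _ _) 0 C hC (fun u hu => (hball u hu).1)
    (fun u hu => by simpa using (hball u hu).2) u t hu (Metric.mem_ball_self hδ)
  simpa using this

lemma gronwall_right (f f' : ℝ → ℝ) (K T : ℝ)
    (hc : ContinuousOn f (Icc 0 T)) (hd : ∀ t ∈ Ioo 0 T, HasDerivAt f (f' t) t)
    (hb : ∀ t ∈ Ioo 0 T, f' t ≤ K * f t) (t : ℝ) (ht : t ∈ Icc 0 T) : f t ≤ f 0 * Real.exp (K * t) := by
  have hder : ∀ t ∈ Ioo 0 T, HasDerivAt (fun t => f t * Real.exp (-(K * t)))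
      (f' t * Real.exp (-(K * t)) + f t * (Real.exp (-(K * t)) * (-(K * 1)))) t := by
    intro t ht
    exact (hd t ht).mul (((hasDerivAt_id t).const_mul K).neg.exp)
  have hanti : AntitoneOn (fun t => f t * Real.exp (-(K * t))) (Icc 0 T) := by
    apply antitoneOn_of_deriv_nonpos (convex_Icc _ _)
    · exact hc.mul (by fun_prop)
    · rw [interior_Icc]
      intro t ht; exact (hder t ht).differentiableAt.differentiableWithinAt
    · rw [interior_Icc]
      intro t ht
      rw [(hder t ht).deriv]
      have := hb t ht
      have h2 := Real.exp_pos (-(K*t))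
      nlinarith
  have h := hanti (show (0:ℝ) ∈ Icc 0 T from ⟨le_rfl, ht.1.trans ht.2⟩) ht ht.1
  simp only [mul_zero, neg_zero, Real.exp_zero, mul_one] at h
  have h2 := mul_le_mul_of_nonneg_right h (Real.exp_pos (K*t)).le
  rwa [mul_assoc, ← Real.exp_add, neg_add_cancel, Real.exp_zero, mul_one] at h2

lemma gronwall_two (f f' : ℝ → ℝ) (K T : ℝ)
    (hc : ContinuousOn f (Icc (-T) T)) (hd : ∀ t ∈ Ioo (-T) T, HasDerivAt f (f' t) t)
    (hb : ∀ t ∈ Ioo (-T) T, |f' t| ≤ K * f t) (t : ℝ) (ht : t ∈ Icc (-T) T) :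
    f t ≤ f 0 * Real.exp (K * |t|) := by
  rcases le_total 0 t with h | h
  · rw [abs_of_nonneg h]
    have hT : 0 ≤ T := h.trans ht.2
    exact gronwall_right f f' K T (hc.mono (Icc_subset_Icc (by linarith) le_rfl))
      (fun t ht => hd t ⟨by linarith [ht.1], ht.2⟩)
      (fun t ht => (le_abs_self _).trans (hb t ⟨by linarith [ht.1], ht.2⟩)) t ⟨h, ht.2⟩
  · rw [abs_of_nonpos h]
    have hT : 0 ≤ T := by linarith [ht.1]
    have := gronwall_right (fun t => f (-t)) (fun t => - f' (-t)) K T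
      (hc.comp continuous_neg.continuousOn (fun t ht => ⟨by linarith [ht.2], by linarith [ht.1]⟩))
      (fun t ht => by
        have h1 := hd (-t) ⟨by linarith [ht.2], by linarith [ht.1]⟩
        have := h1.scomp t (hasDerivAt_neg t)
        exact this.congr_deriv (by simp))
      (fun t ht => (neg_le_abs _).trans (hb (-t) ⟨by linarith [ht.2], by linarith [ht.1]⟩)) (-t)
      ⟨by linarith, by linarith [ht.1]⟩
    simpa using this

lemma inner_deriv_zero {f g : ℝ → XX} {f' : XX} {t : ℝ} (hf : HasDerivAt f f' t) (h0 : f t = 0)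
    (hg : ContinuousAt g t) : HasDerivAt (fun u => inner ℝ (f u) (g u)) (inner ℝ f' (g t)) t := by
  rw [hasDerivAt_iff_tendsto_slope] at hf ⊢
  have h1 : Tendsto g (𝓝[≠] t) (𝓝 (g t)) := hg.mono_left nhdsWithin_le_nhds
  refine (hf.inner (𝕜 := ℝ) h1).congr fun u => ?_
  rw [slope_def_module, slope_def_module, h0, inner_zero_left, sub_zero, sub_zero, real_inner_smul_left, smul_eq_mul]

lemma innerX (x y : XX) : inner ℝ x y = ∑' n, inner ℝ (x n) (y n) := lp.inner_eq_tsum (𝕜 := ℝ) x y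

lemma inner_IX_herm (x y : XX) (hx : HermSymm x) (hy : HermSymm y) : inner ℝ x (IX y) = 0 := by
  have h : inner ℝ x (IX y) = - inner ℝ x (IX y) := by
    conv_lhs => rw [innerX, ← (Equiv.neg ZZ3).tsum_eq]
    rw [innerX, ← tsum_neg]
    apply tsum_congr; intro n
    simp only [Equiv.neg_apply, IX_apply]
    rw [hx n, hy n]
    simp [Complex.inner]
    ring
  linarith

lemma inner_IX (x y : XX) : inner ℝ (IX x) (IX y) = inner ℝ x y := by
  rw [innerX, innerX]
  apply tsum_congr; intro n
  simp [IX_apply, Complex.inner]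

lemma inner_VX (t : ℝ) (x y : XX) : inner ℝ (VX t x) (VX t y) = inner ℝ x y := by
  have h : ∀ x : XX, inner ℝ x x = ‖x‖^2 := fun x => real_inner_self_eq_norm_sq x
  have := VX_norm t (x + y)
  have e := norm_add_sq_real (VX t x) (VX t y)
  rw [← map_add, VX_norm, VX_norm, VX_norm, norm_add_sq_real] at e
  linarith

lemma VX_IX (t : ℝ) (x : XX) : VX t (IX x) = IX (VX t x) := by
  apply lp.ext; funext n
  rw [VX_apply, IX_apply, IX_apply, VX_apply]; ring

/-- the velocity part -/
def BX : XX →L[ℝ] XX := -(RX.comp IX)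

lemma BX_def (x : XX) : BX x = - RX (IX x) := rfl

lemma BX_apply (x : XX) (n : ZZ3) :
    BX x n = (-Complex.I * x n + Complex.I * (starRingEnd ℂ) (x (-n))) / 2 := by
  rw [BX_def, lp.coeFn_neg, Pi.neg_apply, RX_apply, IX_apply, IX_apply]; simp; ring

lemma BX_norm_le (x : XX) : ‖BX x‖ ≤ ‖x‖ := by
  rw [BX_def, norm_neg]; exact (RX_norm_le _).trans (IX_norm_le _)

lemma BX_herm (x : XX) : HermSymm (BX x) := by
  intro n
  have := RX_herm (IX x) n
  rw [BX_def, lp.coeFn_neg, Pi.neg_apply, Pi.neg_apply, this, map_neg]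

lemma RX_BX (x : XX) : RX x + IX (BX x) = x := by
  apply lp.ext; funext n
  rw [lp.coeFn_add, Pi.add_apply, RX_apply, IX_apply, BX_apply]
  linear_combination (-x n/2 + (starRingEnd ℂ) (x (-n))/2) * Complex.I_sq

lemma wave_z (w : ℝ → XX) (t : ℝ) (F : XX) (hw : HasDerivAt w (IX (VX t F)) t) (n : ZZ3) :
    HasDerivAt (fun u => VX (-u) (w u) n) (-Complex.I * jb n * VX (-t) (w t) n + Complex.I * F n) t := by
  have h1 := hw.coord n
  have h2 : HasDerivAt (fun u : ℝ => Complex.exp (((-u * jb n : ℝ) : ℂ) * Complex.I))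
      (Complex.exp (((-t * jb n : ℝ) : ℂ) * Complex.I) * (((-1 * jb n : ℝ) : ℂ) * Complex.I)) t := by
    have h3 : HasDerivAt (fun u : ℝ => -u * jb n) (-1 * jb n) t := (hasDerivAt_neg t).mul_const _
    exact (h3.ofReal_comp.mul_const Complex.I).cexp
  have h4 := h2.mul h1
  simp only [VX_apply, IX_apply] at h4 ⊢
  refine h4.congr_deriv ?_
  have h5 : Complex.exp (((-t * jb n : ℝ) : ℂ) * Complex.I) * Complex.exp (((t * jb n : ℝ) : ℂ) * Complex.I) = 1 := by
    rw [← Complex.exp_add]; simp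
  push_cast at h5 ⊢
  linear_combination (Complex.I * F n) * h5

lemma wave_conj (w : ℝ → XX) (t : ℝ) (F : XX) (hF : HermSymm F) (hw : HasDerivAt w (IX (VX t F)) t) (n : ZZ3) :
    HasDerivAt (fun u => (starRingEnd ℂ) (VX (-u) (w u) (-n)))
      (Complex.I * jb n * (starRingEnd ℂ) (VX (-t) (w t) (-n)) - Complex.I * F n) t := by
  have h1 := wave_z w t F hw (-n)
  have h2 := Complex.conjCLE.hasFDerivAt.comp_hasDerivAt t h1
  have e : (starRingEnd ℂ) (F (-n)) = F n := by rw [hF n, Complex.conj_conj]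
  refine h2.congr_deriv ?_
  simp only [ContinuousLinearEquiv.coe_coe, Complex.conjCLE_apply, map_add, map_mul, map_neg, Complex.conj_I, Complex.conj_ofReal, jb_neg, e]
  ring

lemma wave_R (w : ℝ → XX) (t : ℝ) (F : XX) (hF : HermSymm F) (hw : HasDerivAt w (IX (VX t F)) t) (n : ZZ3) :
    HasDerivAt (fun u => RX (VX (-u) (w u)) n) (jb n * BX (VX (-t) (w t)) n) t := by
  have h := ((wave_z w t F hw n).add (wave_conj w t F hF hw n)).div_const 2
  simp only [RX_apply, BX_apply]
  refine h.congr_deriv ?_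
  ring

lemma wave_B (w : ℝ → XX) (t : ℝ) (F : XX) (hF : HermSymm F) (hw : HasDerivAt w (IX (VX t F)) t) (n : ZZ3) :
    HasDerivAt (fun u => BX (VX (-u) (w u)) n) (-jb n * RX (VX (-t) (w t)) n + F n) t := by
  have h := (((wave_z w t F hw n).const_mul (-Complex.I)).add ((wave_conj w t F hF hw n).const_mul Complex.I)).div_const 2
  simp only [RX_apply, BX_apply]
  refine h.congr_deriv ?_
  linear_combination ((jb n : ℂ) * VX (-t) (w t) n / 2 + jb n * (starRingEnd ℂ) (VX (-t) (w t) (-n))/2 - F n) * Complex.I_sq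
end comp

section energy
open Set Filter Topology

lemma DD_herm (s : ℝ) (hs : 0 ≤ s) (x : XX) (hx : HermSymm x) : HermSymm (DD s hs x) := by
  intro n
  rw [DD_apply, DD_apply, hx n, jb_neg, map_mul, Complex.conj_ofReal]

lemma ja_herm (s : ℝ) (x : XX) (hx : HermSymm x) : HermSymm (ja s x) := by
  intro n
  rw [ja, ja, hx n, jb_neg, map_mul, Complex.conj_ofReal]

lemma conv3_herm (f g h : ZZ3 → ℂ) (hf : HermSymm f) (hg : HermSymm g) (hh : HermSymm h) :
    HermSymm (conv3 f g h) := by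
  intro n
  rw [conv3, conv3, Complex.conj_tsum, ← (Equiv.neg (ZZ3 × ZZ3)).tsum_eq]
  apply tsum_congr; intro p
  simp only [Equiv.neg_apply, Prod.fst_neg, Prod.snd_neg, map_mul]
  rw [hf, hg, ← hh]
  congr 2; abel

lemma TT_herm (s : ℝ) (hs : 0 ≤ s) (x y z : XX) (hx : HermSymm x) (hy : HermSymm y) (hz : HermSymm z) :
    HermSymm (TT s hs x y z) := by
  intro n
  rw [TT_apply, TT_apply, conv3_herm _ _ _ (ja_herm s x hx) (ja_herm s y hy) (ja_herm s z hz) n, jb_neg, map_mul,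
    Complex.conj_ofReal]

lemma herm_sub (x y : XX) (hx : HermSymm x) (hy : HermSymm y) : HermSymm (x - y : XX) := by
  intro n
  simp only [lp.coeFn_sub, Pi.sub_apply, map_sub, hx n, hy n]

lemma FF_herm (s : ℝ) (hs : 0 ≤ s) (z : XX) : HermSymm (FF s hs z) :=
  herm_sub _ _ (DD_herm _ _ _ (RX_herm z)) (TT_herm _ _ _ _ _ (RX_herm z) (RX_herm z) (RX_herm z))

lemma TT_cont (s : ℝ) (hs : 0 ≤ s) : Continuous fun p : XX × XX × XX => TT s hs p.1 p.2.1 p.2.2 := by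
  rw [continuous_iff_continuousAt]
  intro q
  rw [ContinuousAt, tendsto_iff_norm_sub_tendsto_zero]
  have h1 : Continuous fun p : XX × XX × XX => 3 * cR s * (‖p.1 - q.1‖ * ‖p.2.1‖ * ‖p.2.2‖) +
      3 * cR s * (‖q.1‖ * ‖p.2.1 - q.2.1‖ * ‖p.2.2‖) + 3 * cR s * (‖q.1‖ * ‖q.2.1‖ * ‖p.2.2 - q.2.2‖) := by
    fun_prop
  have h2 := h1.tendsto q
  simp only [sub_self, norm_zero, mul_zero, zero_mul, add_zero] at h2
  refine squeeze_zero (fun _ => norm_nonneg _) (fun p => ?_) h2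
  have e : TT s hs p.1 p.2.1 p.2.2 - TT s hs q.1 q.2.1 q.2.2 = TT s hs (p.1 - q.1) p.2.1 p.2.2 +
      TT s hs q.1 (p.2.1 - q.2.1) p.2.2 + TT s hs q.1 q.2.1 (p.2.2 - q.2.2) := by
    rw [TT_sub1, TT_sub2, TT_sub3]; abel
  rw [e]
  refine norm_add₃_le.trans ?_
  gcongr <;> exact TT_norm' s hs _ _ _

/-- abbreviation for s = 0 -/
abbrev T0 (x y z : XX) : XX := TT 0 le_rfl x y z
/-- abbreviation for s = 1 multiplier -/
abbrev D1 (x : XX) : XX := DD 1 zero_le_one x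

lemma ja_zero (x : XX) (n : ZZ3) : ja 0 x n = D1 x n := by
  rw [ja, DD_apply, add_zero]

lemma T0_apply (x y z : XX) (n : ZZ3) : T0 x y z n = conv3 (D1 x) (D1 y) (D1 z) n := by
  rw [TT_apply, Real.rpow_zero, Complex.ofReal_one, one_mul]
  simp only [conv3, ja_zero]

/-- quartic summand -/
def HQ (u x y z : XX) (q : ZZ3 × ZZ3 × ZZ3) : ℂ :=
  (starRingEnd ℂ) (D1 u q.1) * (D1 x q.2.1 * D1 y q.2.2 * D1 z (q.1 - q.2.1 - q.2.2))

lemma HQ_summable (u x y z : XX) : Summable (HQ u x y z) := by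
  apply Summable.of_norm
  have h : ∑' q, ‖HQ u x y z q‖ₑ ≠ ⊤ := by
    rw [ENNReal.tsum_prod']
    have e : ∀ n, ∑' p : ZZ3 × ZZ3, ‖HQ u x y z (n, p)‖ₑ = ‖D1 u n‖ₑ * acv 0 x y z n := by
      intro n
      rw [acv, Real.rpow_zero, ENNReal.ofReal_one, one_mul, cv, ← ENNReal.tsum_mul_left]
      apply tsum_congr; intro p
      simp only [HQ, enorm_mul, ja_zero]
      congr 1
      simp [← ofReal_norm]
    simp only [e]
    have h1 := enn_cs (fun n => ‖D1 u n‖ₑ) (acv 0 x y z)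
    have h2 : sq2 (fun n => ‖D1 u n‖ₑ) * sq2 (acv 0 x y z) < ⊤ := by
      refine ENNReal.mul_lt_top ?_ (acv_lt 0 le_rfl x y z)
      rw [sq2_eq]; exact ENNReal.pow_lt_top enorm_lt_top
    have h3 := h1.trans_lt h2
    intro h; rw [h] at h3; simp at h3
  have := ENNReal.summable_toReal h
  simpa using this

lemma Q4_eq (u x y z : XX) : inner ℝ (D1 u) (T0 x y z) = (∑' q, HQ u x y z q).re := by
  have hs := HQ_summable u x y z
  rw [hs.tsum_prod, Complex.re_tsum hs.prod, innerX]
  apply tsum_congr; intro n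
  have : ∑' p : ZZ3 × ZZ3, HQ u x y z (n, p) = (starRingEnd ℂ) (D1 u n) * T0 x y z n := by
    rw [T0_apply, conv3, ← tsum_mul_left]; rfl
  rw [this, Complex.inner, mul_comm]

/-- swap equivalence -/
def swQ : ZZ3 × ZZ3 × ZZ3 ≃ ZZ3 × ZZ3 × ZZ3 where
  toFun q := (-q.2.1, -q.1, q.2.2)
  invFun q := (-q.2.1, -q.1, q.2.2)
  left_inv q := by simp
  right_inv q := by simp

/-- shear equivalence -/
def shQ : ZZ3 × ZZ3 × ZZ3 ≃ ZZ3 × ZZ3 × ZZ3 where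
  toFun q := (q.1 + q.2.1, q.2.1, q.2.2)
  invFun q := (q.1 - q.2.1, q.2.1, q.2.2)
  left_inv q := by simp
  right_inv q := by simp

lemma Q4_swap (u x y z : XX) (hu : HermSymm u) (hx : HermSymm x) :
    inner ℝ (D1 u) (T0 x y z) = inner ℝ (D1 x) (T0 u y z) := by
  rw [Q4_eq, Q4_eq, ← swQ.tsum_eq]
  congr 1
  apply tsum_congr; rintro ⟨n, m, k⟩
  have h1 : D1 u (-m) = (starRingEnd ℂ) (D1 u m) := DD_herm _ _ u hu m
  have h2 : D1 x (-n) = (starRingEnd ℂ) (D1 x n) := DD_herm _ _ x hx n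
  simp only [HQ, swQ, Equiv.coe_fn_mk]
  rw [h1, h2, Complex.conj_conj, show -m - -n - k = n - m - k by abel]
  ring

lemma Q4_pos (x : XX) (hx : HermSymm x) : 0 ≤ inner ℝ (D1 x) (T0 x x x) := by
  have hs := (shQ.summable_iff (f := HQ x x x x)).2 (HQ_summable x x x x)
  rw [Q4_eq, ← shQ.tsum_eq]
  change Summable (fun q => HQ x x x x (shQ q)) at hs
  rw [hs.tsum_prod, Complex.re_tsum hs.prod]
  apply tsum_nonneg
  intro j
  have hsj := hs.prod_factor j
  rw [hsj.tsum_prod]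
  have h1 : ∀ m k, HQ x x x x (shQ (j, m, k)) = ((starRingEnd ℂ) (D1 x (j + m)) * D1 x m) * (D1 x k * D1 x (j - k)) := by
    intro m k
    simp only [HQ, shQ, Equiv.coe_fn_mk]
    rw [show j + m - m - k = j - k by abel]; ring
  simp only [h1, tsum_mul_left, tsum_mul_right]
  have h2 : ∑' m, (starRingEnd ℂ) (D1 x (j + m)) * D1 x m = (starRingEnd ℂ) (∑' k, D1 x k * D1 x (j - k)) := by
    rw [Complex.conj_tsum, ← (Equiv.neg ZZ3).tsum_eq]
    apply tsum_congr; intro m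
    have h3 : D1 x (-m) = (starRingEnd ℂ) (D1 x m) := DD_herm _ _ x hx m
    rw [Equiv.neg_apply, h3, map_mul, ← sub_eq_add_neg]; ring
  rw [h2, mul_comm, Complex.mul_conj]
  simpa using Complex.normSq_nonneg _

lemma Q4_diff (x y : XX) (hx : HermSymm x) (hy : HermSymm y) :
    inner ℝ (D1 x) (T0 x x x) - inner ℝ (D1 y) (T0 y y y) =
      inner ℝ (D1 x - D1 y) (T0 x x x + T0 y x x + T0 y y x + T0 y y y) := by
  have e1 := Q4_swap y x x x hy hx
  have e2 := Q4_swap y x y x hy hx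
  have e3 := Q4_swap y x y y hy hx
  have s1 : T0 x y x = T0 y x x := TT_sw12 _ _ _ _ _
  have s2 : T0 x y y = T0 y y x := by
    change TT _ _ _ _ _ = TT _ _ _ _ _
    rw [TT_sw12, TT_sw23]
  rw [s1] at e2
  rw [s2] at e3
  simp only [inner_sub_left, inner_add_right]
  linarith

/-- energy -/
def EN (w z : XX) : ℝ := 1/2 * ‖w‖^2 + 1/4 * inner ℝ (D1 (RX z)) (T0 (RX z) (RX z) (RX z))

lemma EN_le (w z : XX) (h : ‖z‖ = ‖w‖) : EN w z ≤ 1/2 * ‖w‖^2 + 3/4 * cR 0 * ‖w‖^4 := by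
  have h1 := real_inner_le_norm (D1 (RX z)) (T0 (RX z) (RX z) (RX z))
  have h2 := TT_norm' 0 le_rfl (RX z) (RX z) (RX z)
  have h3 : ‖RX z‖ ≤ ‖w‖ := h ▸ RX_norm_le z
  have h4 : ‖D1 (RX z)‖ ≤ ‖w‖ := (DD_norm_le _ _ _).trans h3
  have hc := cR_nonneg 0
  have h5 : ‖D1 (RX z)‖ * ‖T0 (RX z) (RX z) (RX z)‖ ≤ ‖w‖ * (3 * cR 0 * (‖w‖ * ‖w‖ * ‖w‖)) := by
    gcongr
    exact h2.trans (by gcongr)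
  rw [EN]; nlinarith

lemma EN_ge (w z : XX) : 1/2 * ‖w‖^2 ≤ EN w z := by
  have := Q4_pos (RX z) (RX_herm z)
  rw [EN]; linarith

lemma z_cont (w : ℝ → XX) (S : Set ℝ) (hw : ContinuousOn w S) : ContinuousOn (fun u => VX (-u) (w u)) S :=
  Continuous.comp_continuousOn (g := fun p : ℝ × XX => VX p.1 p.2) (f := fun u : ℝ => (-u, w u)) VX_cont2
    (ContinuousOn.prodMk continuous_neg.continuousOn hw)

lemma EN_cont (w : ℝ → XX) (S : Set ℝ) (hw : ContinuousOn w S) :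
    ContinuousOn (fun u => EN (w u) (VX (-u) (w u))) S := by
  have h1 : ContinuousOn (fun u => RX (VX (-u) (w u))) S := RX.continuous.comp_continuousOn (z_cont w S hw)
  have h2 : ContinuousOn (fun u => D1 (RX (VX (-u) (w u)))) S := (DD 1 _).continuous.comp_continuousOn h1
  have h3 : ContinuousOn (fun u => T0 (RX (VX (-u) (w u))) (RX (VX (-u) (w u))) (RX (VX (-u) (w u)))) S :=
    Continuous.comp_continuousOn (g := fun p : XX × XX × XX => TT 0 le_rfl p.1 p.2.1 p.2.2)
      (f := fun u : ℝ => (RX (VX (-u) (w u)), RX (VX (-u) (w u)), RX (VX (-u) (w u)))) (TT_cont 0 le_rfl)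
      (ContinuousOn.prodMk h1 (ContinuousOn.prodMk h1 h1))
  have h4 : ContinuousOn (fun u => inner ℝ (D1 (RX (VX (-u) (w u)))) (T0 (RX (VX (-u) (w u))) (RX (VX (-u) (w u))) (RX (VX (-u) (w u))))) S :=
    h2.inner (𝕜 := ℝ) h3
  have h5 : ContinuousOn (fun u => ‖w u‖^2) S := hw.norm.pow 2
  unfold EN
  exact (h5.const_smul (1/2:ℝ)).add (h4.const_smul (1/4:ℝ))

lemma D1_deriv (w : ℝ → XX) (I : Set ℝ) (hI : IsOpen I) (F : ℝ → XX) (hF : ∀ u, HermSymm (F u))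
    (hw : ∀ u ∈ I, HasDerivAt w (IX (VX u (F u))) u) (t : ℝ) (ht : t ∈ I) :
    HasDerivAt (fun u => D1 (RX (VX (-u) (w u)))) (BX (VX (-t) (w t))) t := by
  have hc : ContinuousOn w I := fun u hu => (hw u hu).continuousAt.continuousWithinAt
  apply comp_hasDerivAt _ (fun u => BX (VX (-u) (w u)))
  · filter_upwards [hI.mem_nhds ht] with u hu n
    have h := (wave_R w u (F u) (hF u) (hw u hu) n).const_mul ((jb n ^ (-1:ℝ) : ℝ) : ℂ)
    simp only [DD_apply]
    refine h.congr_deriv ?_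
    rw [← mul_assoc, ← Complex.ofReal_mul, Real.rpow_neg_one, inv_mul_cancel₀ (jb_pos n).ne',
      Complex.ofReal_one, one_mul]
  · exact (BX.continuous.comp_continuousOn (z_cont w I hc)).continuousAt (hI.mem_nhds ht)

lemma EN_deriv (w : ℝ → XX) (I : Set ℝ) (hI : IsOpen I) 
    (hw : ∀ u ∈ I, HasDerivAt w (GG 0 le_rfl u (w u)) u) (t : ℝ) (ht : t ∈ I) :
    HasDerivAt (fun u => EN (w u) (VX (-u) (w u)))
      (inner ℝ (BX (VX (-t) (w t))) (D1 (RX (VX (-t) (w t))))) t := by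
  have hc : ContinuousOn w I := fun u hu => (hw u hu).continuousAt.continuousWithinAt
  have hd := D1_deriv w I hI (fun u => FF 0 le_rfl (VX (-u) (w u))) (fun u => FF_herm _ _ _) hw t ht
  have hα : ContinuousAt (fun u => RX (VX (-u) (w u))) t :=
    (RX.continuous.comp_continuousOn (z_cont w I hc)).continuousAt (hI.mem_nhds ht)
  have hk : ContinuousAt (fun _ : ℝ => RX (VX (-t) (w t))) t := continuousAt_const
  have hT : ∀ f g h : ℝ → XX, ContinuousAt f t → ContinuousAt g t → ContinuousAt h t →
      ContinuousAt (fun u => T0 (f u) (g u) (h u)) t := by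
    intro f g h hf hg hh
    exact ContinuousAt.comp (f := fun u => (f u, g u, h u)) (TT_cont 0 le_rfl).continuousAt (hf.prodMk (hg.prodMk hh))
  set α : ℝ → XX := fun u => RX (VX (-u) (w u)) with hαd
  set β := BX (VX (-t) (w t)) with hβ
  have h1 : HasDerivAt (fun u => D1 (α u) - D1 (α t)) β t := hd.sub_const _
  have hcont : ContinuousAt (fun u => T0 (α u) (α u) (α u) + T0 (α t) (α u) (α u) + T0 (α t) (α t) (α u) + T0 (α t) (α t) (α t)) t :=
    (((hT _ _ _ hα hα hα).add (hT _ _ _ hk hα hα)).add (hT _ _ _ hk hk hα)).add (hT _ _ _ hk hk hk)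
  have h2 := inner_deriv_zero h1 (sub_self _) hcont
  have h3 : HasDerivAt (fun u => inner ℝ (D1 (α u)) (T0 (α u) (α u) (α u)))
      (inner ℝ β (T0 (α t) (α t) (α t) + T0 (α t) (α t) (α t) + T0 (α t) (α t) (α t) + T0 (α t) (α t) (α t))) t := by
    have h4 := h2.add_const (inner ℝ (D1 (α t)) (T0 (α t) (α t) (α t)))
    refine h4.congr_of_eventuallyEq (Eventually.of_forall fun u => ?_)
    have := Q4_diff (α u) (α t) (RX_herm _) (RX_herm _)
    simp only
    linarith
  have h5 := (hw t ht).norm_sq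
  have h6 := (h5.const_mul (1/2)).add (h3.const_mul (1/4))
  refine h6.congr_deriv ?_
  have h7 : inner ℝ (w t) (GG 0 le_rfl t (w t)) = inner ℝ β (FF 0 le_rfl (VX (-t) (w t))) := by
    set z := VX (-t) (w t) with hz
    have e1 : w t = VX t z := by rw [hz, VX_neg]
    have e2 : GG 0 le_rfl t (w t) = VX t (IX (FF 0 le_rfl z)) := by rw [GG, VX_IX]
    rw [e2]
    conv_lhs => rw [e1, inner_VX, ← RX_BX z, inner_add_left, RX_BX z, inner_IX,
      inner_IX_herm _ _ (RX_herm z) (FF_herm _ _ z), zero_add]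
  rw [h7, FF, inner_sub_right]
  simp only [inner_add_right]
  change 1 / 2 * (2 * (inner ℝ β (D1 (α t)) - inner ℝ β (T0 (α t) (α t) (α t)))) + _ = inner ℝ β (D1 (α t))
  ring

lemma energy_bound (w : ℝ → XX) (T : ℝ) (hT : 0 ≤ T) (hc : ContinuousOn w (Icc (-T) T))
    (hw : ∀ u ∈ Ioo (-T) T, HasDerivAt w (GG 0 le_rfl u (w u)) u) (t : ℝ) (ht : t ∈ Icc (-T) T) :
    ‖w t‖ ^ 2 ≤ (‖w 0‖^2 + 2 * cR 0 * ‖w 0‖^4) * Real.exp (2 * T) := by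
  have h := gronwall_two _ _ 2 T (EN_cont w _ hc) (EN_deriv w _ isOpen_Ioo hw) (by
    intro u hu
    refine (abs_real_inner_le_norm _ _).trans ?_
    have h1 : ‖BX (VX (-u) (w u))‖ ≤ ‖w u‖ := (BX_norm_le _).trans (VX_norm_le _ _)
    have h2 : ‖D1 (RX (VX (-u) (w u)))‖ ≤ ‖w u‖ :=
      (DD_norm_le _ _ _).trans ((RX_norm_le _).trans (VX_norm_le _ _))
    have h3 := EN_ge (w u) (VX (-u) (w u))
    have h4 : ‖BX (VX (-u) (w u))‖ * ‖D1 (RX (VX (-u) (w u)))‖ ≤ ‖w u‖ * ‖w u‖ := by gcongr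
    nlinarith) t ht
  have h1 := EN_ge (w t) (VX (-t) (w t))
  have h2 := EN_le (w 0) (VX (-0) (w 0)) (VX_norm _ _)
  have h3 : Real.exp (2 * |t|) ≤ Real.exp (2 * T) := Real.exp_le_exp.2 (by linarith [abs_le.2 ht])
  have hc := cR_nonneg 0
  have h4 : EN (w 0) (VX (-0) (w 0)) * Real.exp (2 * |t|) ≤
      (1/2 * ‖w 0‖^2 + 3/4 * cR 0 * ‖w 0‖^4) * Real.exp (2 * T) := by gcongr
  have h5 : 0 ≤ cR 0 * ‖w 0‖^4 * Real.exp (2 * T) := by positivity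
  have h6 := h1.trans (h.trans h4)
  calc ‖w t‖^2 ≤ 2 * ((1/2 * ‖w 0‖^2 + 3/4 * cR 0 * ‖w 0‖^4) * Real.exp (2 * T)) := by linarith
    _ = (‖w 0‖^2) * Real.exp (2 * T) + 3/2 * (cR 0 * ‖w 0‖^4 * Real.exp (2 * T)) := by ring
    _ ≤ (‖w 0‖^2) * Real.exp (2 * T) + 2 * (cR 0 * ‖w 0‖^4 * Real.exp (2 * T)) := by linarith
    _ = _ := by ring

lemma DD_RX (s : ℝ) (hs : 0 ≤ s) (x : XX) : DD s hs (RX x) = RX (DD s hs x) := by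
  apply lp.ext; funext n
  rw [DD_apply, RX_apply, RX_apply, DD_apply, DD_apply, jb_neg, map_mul, Complex.conj_ofReal]; ring

lemma DD_VX (s : ℝ) (hs : 0 ≤ s) (t : ℝ) (x : XX) : DD s hs (VX t x) = VX t (DD s hs x) := by
  apply lp.ext; funext n
  rw [DD_apply, VX_apply, VX_apply, DD_apply]; ring

lemma DD_IX (s : ℝ) (hs : 0 ≤ s) (x : XX) : DD s hs (IX x) = IX (DD s hs x) := by
  apply lp.ext; funext n
  rw [DD_apply, IX_apply, IX_apply, DD_apply]; ring

lemma ja_DD (s : ℝ) (hs : 0 ≤ s) (x : XX) : ja s x = ja 0 (DD s hs x) := by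
  funext n
  rw [ja, ja, DD_apply, ← mul_assoc, ← Complex.ofReal_mul, ← Real.rpow_add (jb_pos n)]
  congr 3; ring

lemma DD_TT (s : ℝ) (hs : 0 ≤ s) (x y z : XX) :
    DD s hs (TT s hs x y z) = T0 (DD s hs x) (DD s hs y) (DD s hs z) := by
  apply lp.ext; funext n
  rw [DD_apply, TT_apply, TT_apply, ja_DD s hs, ja_DD s hs, ja_DD s hs, ← mul_assoc, ← Complex.ofReal_mul,
    ← Real.rpow_add (jb_pos n), neg_add_cancel]

lemma DD_comm (s : ℝ) (hs : 0 ≤ s) (x : XX) : DD s hs (D1 x) = D1 (DD s hs x) := by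
  apply lp.ext; funext n
  exact mul_left_comm _ _ _

lemma DD_FF (s : ℝ) (hs : 0 ≤ s) (z : XX) : DD s hs (FF s hs z) = FF 0 le_rfl (DD s hs z) := by
  rw [FF, FF, map_sub, DD_TT, ← DD_RX s hs]
  congr 1
  exact DD_comm s hs (RX z)

lemma DD_GG (s : ℝ) (hs : 0 ≤ s) (t : ℝ) (w : XX) : DD s hs (GG s hs t w) = GG 0 le_rfl t (DD s hs w) := by
  rw [GG, GG, DD_IX, DD_VX, DD_FF, DD_VX]

lemma FF_tame (s : ℝ) (hs : 0 ≤ s) (z : XX) (K : ℝ) (hK : ‖DD s hs z‖ ≤ K) :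
    ‖FF s hs z‖ ≤ (1 + 3 * cR s * K^2) * ‖z‖ := by
  have hc := cR_nonneg s
  have hK0 : 0 ≤ K := (norm_nonneg _).trans hK
  have h1 : ‖DD s hs (RX z)‖ ≤ K := by rw [DD_RX]; exact (RX_norm_le _).trans hK
  have h2 : ‖RX z‖ ≤ ‖z‖ := RX_norm_le z
  have h3 := TT_norm s hs (RX z) (RX z) (RX z)
  have h4 : ‖TT s hs (RX z) (RX z) (RX z)‖ ≤ cR s * (‖z‖ * K * K + K * ‖z‖ * K + K * K * ‖z‖) :=
    h3.trans (by gcongr)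
  have h5 : ‖DD 1 zero_le_one (RX z)‖ ≤ ‖z‖ := (DD_norm_le _ _ _).trans h2
  rw [FF]
  refine (norm_sub_le _ _).trans ?_
  linarith

lemma apriori (s : ℝ) (hs : 0 ≤ s) (x₀ : XX) (T : ℝ) (hT : 0 < T) : ∃ B : ℝ, ∀ T', 0 < T' → T' ≤ T →
    ∀ w : ℝ → XX, ContinuousOn w (Icc (-T') T') →
      (∀ t ∈ Ioo (-T') T', HasDerivAt w (GG s hs t (w t)) t) → w 0 = x₀ → ∀ t ∈ Icc (-T') T', ‖w t‖ ≤ B := by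
  have hc0 := cR_nonneg 0
  have hc := cR_nonneg s
  set K := Real.sqrt ((‖DD s hs x₀‖^2 + 2 * cR 0 * ‖DD s hs x₀‖^4) * Real.exp (2 * T)) with hKd
  set C := 2 * (1 + 3 * cR s * K^2) with hC
  have hC0 : 0 ≤ C := by positivity
  refine ⟨Real.sqrt (‖x₀‖^2 * Real.exp (C * T)), ?_⟩
  intro T' hT' hle w hwc hw hw0 t ht
  have hlow : ∀ u ∈ Icc (-T') T', ‖DD s hs (w u)‖ ≤ K := by
    intro u hu
    have := energy_bound (fun u => DD s hs (w u)) T' hT'.le ((DD s hs).continuous.comp_continuousOn hwc)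
      (fun u hu => by
        have h1 := (DD s hs).hasFDerivAt.comp_hasDerivAt u (hw u hu)
        exact h1.congr_deriv (DD_GG s hs u (w u))) u hu
    simp only [hw0] at this
    apply Real.le_sqrt_of_sq_le
    refine this.trans ?_
    gcongr
  have h := gronwall_two (fun u => ‖w u‖^2) (fun u => 2 * inner ℝ (w u) (GG s hs u (w u))) C T'
    (hwc.norm.pow 2) (fun u hu => (hw u hu).norm_sq) (by
      intro u hu
      rw [abs_mul, abs_two]
      have h1 := abs_real_inner_le_norm (w u) (GG s hs u (w u))
      have h2 : ‖GG s hs u (w u)‖ ≤ (1 + 3 * cR s * K^2) * ‖w u‖ := by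
        rw [GG]
        refine (IX_norm_le _).trans ((VX_norm_le _ _).trans ?_)
        refine (FF_tame s hs _ K ?_).trans ?_
        · rw [DD_VX, VX_norm]; exact hlow u (Ioo_subset_Icc_self hu)
        · rw [VX_norm]
      have h3 : ‖w u‖ * ‖GG s hs u (w u)‖ ≤ ‖w u‖ * ((1 + 3 * cR s * K^2) * ‖w u‖) := by gcongr
      rw [hC]; nlinarith) t ht
  simp only [hw0] at h
  apply Real.le_sqrt_of_sq_le
  refine h.trans ?_
  gcongr
  exact (abs_le.2 ht).trans hle

end energy

section final
open Set Filter Topology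

lemma weight_eq (τ : ℝ) (n : ZZ3) : (1 + (nsqZ n : ℝ)) ^ τ = (jb n ^ τ) ^ 2 := by
  rw [← jb_sq, ← Real.rpow_natCast, ← Real.rpow_natCast, ← Real.rpow_mul (jb_pos n).le,
    ← Real.rpow_mul (jb_pos n).le, mul_comm]

lemma hNormSq_eq (τ : ℝ) (a : ZZ3 → ℂ) : hNormSq τ a = sq2 (fun n => ‖((jb n ^ τ : ℝ) : ℂ) * a n‖ₑ) := by
  rw [hNormSq, sq2]
  apply tsum_congr; intro n
  have := Real.rpow_nonneg (jb_pos n).le τ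
  rw [weight_eq, enorm_mul, mul_pow, ENNReal.ofReal_pow this, enorm_eq_nnnorm (a n),
    ← ofReal_norm ((jb n ^ τ : ℝ) : ℂ), Complex.norm_real, Real.norm_of_nonneg this]

/-- weighted sequence -/
def mkX (τ : ℝ) (a : ZZ3 → ℂ) (h : hNormSq τ a ≠ ⊤) : XX :=
  ⟨fun n => ((jb n ^ τ : ℝ) : ℂ) * a n, memX (by rwa [← hNormSq_eq])⟩

lemma mkX_apply (τ : ℝ) (a : ZZ3 → ℂ) (h : hNormSq τ a ≠ ⊤) (n : ZZ3) :
    mkX τ a h n = ((jb n ^ τ : ℝ) : ℂ) * a n := rfl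

lemma mkX_norm (τ : ℝ) (a : ZZ3 → ℂ) (h : hNormSq τ a ≠ ⊤) : ‖mkX τ a h‖ₑ = hNormSq τ a ^ (1/2 : ℝ) := by
  have e : ‖mkX τ a h‖ₑ ^ 2 = hNormSq τ a := by rw [← sq2_eq, hNormSq_eq]; rfl
  rw [← e, ← ENNReal.rpow_natCast, ← ENNReal.rpow_mul]; norm_num

lemma mkX_herm (τ : ℝ) (a : ZZ3 → ℂ) (h : hNormSq τ a ≠ ⊤) (ha : HermSymm a) : HermSymm (mkX τ a h) := by
  intro n
  rw [mkX_apply, mkX_apply, ha n, jb_neg, map_mul, Complex.conj_ofReal]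

lemma jb_cancel (τ : ℝ) (n : ZZ3) : ((jb n ^ τ : ℝ) : ℂ) * ((jb n ^ (-τ) : ℝ) : ℂ) = 1 := by
  rw [← Complex.ofReal_mul, ← Real.rpow_add (jb_pos n), add_neg_cancel, Real.rpow_zero, Complex.ofReal_one]

lemma jb_split (s : ℝ) (n : ZZ3) : ((jb n ^ (1+s) : ℝ) : ℂ) = jb n * ((jb n ^ s : ℝ) : ℂ) := by
  rw [Real.rpow_add (jb_pos n), Real.rpow_one, Complex.ofReal_mul]

lemma jb_sqC (n : ZZ3) : (jb n : ℂ)^2 = 1 + ((nsqZ n : ℝ) : ℂ) := by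
  rw [← Complex.ofReal_pow, jb_sq]; push_cast; rfl

lemma hNormSq_inv (τ : ℝ) (x : XX) :
    hNormSq τ (fun n => ((jb n ^ (-τ) : ℝ) : ℂ) * x n) ^ (1/2 : ℝ) = ‖x‖ₑ := by
  have e : hNormSq τ (fun n => ((jb n ^ (-τ) : ℝ) : ℂ) * x n) = ‖x‖ₑ ^ 2 := by
    rw [hNormSq_eq, ← sq2_eq]
    congr 1; funext n
    rw [← mul_assoc, jb_cancel, one_mul]
  rw [e, ← ENNReal.rpow_natCast, ← ENNReal.rpow_mul]; norm_num

lemma ja_mkX (s : ℝ) (a : ZZ3 → ℂ) (h : hNormSq (1+s) a ≠ ⊤) : ja s (mkX (1+s) a h) = a := by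
  funext n
  rw [ja, mkX_apply, ← mul_assoc, mul_comm ((jb n ^ (-(1+s)) : ℝ) : ℂ), jb_cancel, one_mul]

lemma RX_IX_herm (y : XX) (hy : HermSymm y) : RX (IX y) = 0 := by
  apply lp.ext; funext n
  rw [RX_apply, IX_apply, IX_apply, hy n]; simp

lemma IX_IX (y : XX) : IX (IX y) = -y := by
  apply lp.ext; funext n
  rw [IX_apply, IX_apply, ← mul_assoc, Complex.I_mul_I, lp.coeFn_neg, Pi.neg_apply, neg_one_mul]

lemma RX_comb (x y : XX) (hx : HermSymm x) (hy : HermSymm y) : RX (x + IX y) = x := by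
  rw [map_add, RX_of_herm x hx, RX_IX_herm y hy, add_zero]

lemma BX_comb (x y : XX) (hx : HermSymm x) (hy : HermSymm y) : BX (x + IX y) = y := by
  rw [BX_def, map_add, IX_IX, map_add, RX_IX_herm x hx, map_neg, RX_of_herm y hy, zero_add, neg_neg]

lemma FF_apply (s : ℝ) (hs : 0 ≤ s) (z : XX) (n : ZZ3) :
    FF s hs z n = ((jb n ^ (-1:ℝ) : ℝ) : ℂ) * RX z n -
      ((jb n ^ s : ℝ) : ℂ) * conv3 (ja s (RX z)) (ja s (RX z)) (ja s (RX z)) n := rfl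

/-- solution predicate, with σ = 1 + s -/
def IsSol (s : ℝ) (a₀ b₀ : ZZ3 → ℂ) (a : ℝ → ZZ3 → ℂ) : Prop :=
      (∀ n, ContDiff ℝ 2 (fun t => a t n)) ∧
      (∀ t, HermSymm (a t)) ∧
      (∀ T : ℝ, 0 < T → ∃ M : ℝ≥0∞, M ≠ ⊤ ∧ ∀ t ∈ Set.Icc (-T) T,
          hNormSq (1+s) (a t) ^ (1/2 : ℝ)
            + hNormSq s (fun n => deriv (fun t' => a t' n) t) ^ (1/2 : ℝ) ≤ M) ∧
      (∀ (t : ℝ) (n : Fin 3 → ℤ),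
          Summable (fun p : (Fin 3 → ℤ) × (Fin 3 → ℤ) =>
            a t p.1 * a t p.2 * a t (n - p.1 - p.2)) ∧
          deriv (deriv (fun t' => a t' n)) t
            = -(((nsqZ n : ℝ)) : ℂ) * a t n
              - ∑' p : (Fin 3 → ℤ) × (Fin 3 → ℤ), a t p.1 * a t p.2 * a t (n - p.1 - p.2)) ∧
      (∀ n, a 0 n = a₀ n) ∧
      (∀ n, deriv (fun t => a t n) 0 = b₀ n)

lemma GG_cont_w (s : ℝ) (hs : 0 ≤ s) (w : ℝ → XX) (hw : Continuous w) :
    Continuous fun t => GG s hs t (w t) :=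
  Continuous.comp (g := fun p : ℝ × XX => GG s hs p.1 p.2) (f := fun t : ℝ => (t, w t)) (GG_cont s hs)
    (Continuous.prodMk continuous_id hw)

lemma GG_cont_t (s : ℝ) (hs : 0 ≤ s) (x : XX) : Continuous fun t => GG s hs t x :=
  GG_cont_w s hs (fun _ => x) continuous_const

set_option maxHeartbeats 2000000 in
lemma sol_exists (s : ℝ) (hs : 0 ≤ s) (a₀ b₀ : ZZ3 → ℂ) (ha : HermSymm a₀) (hb : HermSymm b₀)
    (hna : hNormSq (1+s) a₀ ≠ ⊤) (hnb : hNormSq s b₀ ≠ ⊤) : ∃ a, IsSol s a₀ b₀ a := by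
  have hA := mkX_herm _ a₀ hna ha
  have hB := mkX_herm _ b₀ hnb hb
  obtain ⟨w, hw0, hw⟩ := ode_global (GG s hs) (lipF s) (lipF_nonneg s)
    (fun x => GG_cont_t s hs x)
    (GG_lip s hs) (GG_bdd s hs) (mkX (1+s) a₀ hna + IX (mkX s b₀ hnb)) (apriori s hs _)
  have hwc : Continuous w := continuous_iff_continuousAt.2 fun t => (hw t).continuousAt
  set z : ℝ → XX := fun t => VX (-t) (w t) with hz
  have hzc : Continuous z := by
    have := z_cont w univ hwc.continuousOn
    rwa [← continuousOn_univ]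
  have hzn : ∀ t, ‖z t‖ = ‖w t‖ := fun t => VX_norm _ _
  have hz0 : z 0 = mkX (1+s) a₀ hna + IX (mkX s b₀ hnb) := by
    rw [hz]; simp only [neg_zero, VX_zero]; exact hw0
  let a : ℝ → ZZ3 → ℂ := fun t => ja s (RX (z t))
  let b : ℝ → ZZ3 → ℂ := fun t n => ((jb n ^ (-s) : ℝ) : ℂ) * BX (z t) n
  let c : ℝ → ZZ3 → ℂ := fun t n => ((jb n ^ (-s) : ℝ) : ℂ) * (-jb n * RX (z t) n + FF s hs (z t) n)
  have hda : ∀ t n, HasDerivAt (fun t => a t n) (b t n) t := by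
    intro t n
    have h := (wave_R w t _ (FF_herm s hs (z t)) (hw t) n).const_mul ((jb n ^ (-(1+s)) : ℝ) : ℂ)
    refine h.congr_deriv ?_
    simp only [b]
    rw [← mul_assoc, ← Complex.ofReal_mul]
    congr 3
    conv_lhs => rw [← Real.rpow_one (jb n), ← Real.rpow_mul (jb_pos n).le, ← Real.rpow_add (jb_pos n)]
    congr 1; ring
  have hdb : ∀ t n, HasDerivAt (fun t => b t n) (c t n) t := by
    intro t n
    exact (wave_B w t _ (FF_herm s hs (z t)) (hw t) n).const_mul ((jb n ^ (-s) : ℝ) : ℂ)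
  have hcc : ∀ n, Continuous fun t => c t n := by
    intro n
    have h1 : Continuous fun t => RX (z t) n := (evX n).continuous.comp (RX.continuous.comp hzc)
    have h2 : Continuous fun t => FF s hs (z t) n := (evX n).continuous.comp ((FF_cont s hs).comp hzc)
    exact continuous_const.mul ((continuous_const.mul h1).add h2)
  have hd1 : ∀ n, deriv (fun t => a t n) = fun t => b t n := fun n => funext fun t => (hda t n).deriv
  have hd2 : ∀ n, deriv (fun t => b t n) = fun t => c t n := fun n => funext fun t => (hdb t n).deriv
  refine ⟨a, ?_, ?_, ?_, ?_, ?_, ?_⟩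
  · intro n
    rw [show (2 : WithTop ℕ∞) = 1 + 1 by norm_num, contDiff_succ_iff_deriv]
    refine ⟨fun t => (hda t n).differentiableAt, by simp, ?_⟩
    rw [hd1, contDiff_one_iff_deriv, hd2]
    exact ⟨fun t => (hdb t n).differentiableAt, hcc n⟩
  · intro t
    exact ja_herm s _ (RX_herm _)
  · intro T hT
    obtain ⟨C, hC⟩ := isCompact_Icc.exists_bound_of_continuousOn (hwc.continuousOn (s := Icc (-T) T))
    refine ⟨ENNReal.ofReal C + ENNReal.ofReal C, by simp, fun t ht => ?_⟩
    have h1 : hNormSq (1+s) (a t) ^ (1/2 : ℝ) = ‖RX (z t)‖ₑ := hNormSq_inv (1+s) (RX (z t))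
    have h2 : hNormSq s (fun n => deriv (fun t' => a t' n) t) ^ (1/2 : ℝ) = ‖BX (z t)‖ₑ := by
      simp only [hd1]
      exact hNormSq_inv s (BX (z t))
    rw [h1, h2, ← ofReal_norm, ← ofReal_norm]
    gcongr
    · exact ((RX_norm_le _).trans (hzn t).le).trans (hC t ht)
    · exact ((BX_norm_le _).trans (hzn t).le).trans (hC t ht)
  · intro t n
    refine ⟨(summable_conv s hs (RX (z t)) (RX (z t)) (RX (z t)) n).of_norm, ?_⟩
    rw [hd1, hd2]
    change c t n = -((nsqZ n : ℝ) : ℂ) * a t n - conv3 (a t) (a t) (a t) n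
    simp only [c]
    rw [FF_apply]
    change _ = -((nsqZ n : ℝ) : ℂ) * (((jb n ^ (-(1+s)) : ℝ) : ℂ) * RX (z t) n) - conv3 (a t) (a t) (a t) n
    have e1 : ((jb n ^ (-(1+s)) : ℝ) : ℂ) = ((jb n ^ (-s) : ℝ) : ℂ) * ((jb n ^ (-1:ℝ) : ℝ) : ℂ) := by
      rw [← Complex.ofReal_mul, ← Real.rpow_add (jb_pos n)]; congr 2; ring
    have e2 := jb_cancel s n
    have e3 := jb_sqC n
    have e4 : (jb n : ℂ) * ((jb n ^ (-1:ℝ) : ℝ) : ℂ) = 1 := by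
      have := jb_cancel 1 n
      rwa [Real.rpow_one] at this
    rw [e1]
    change ((jb n ^ (-s) : ℝ) : ℂ) * (-(jb n : ℂ) * RX (z t) n + (((jb n ^ (-1:ℝ) : ℝ) : ℂ) * RX (z t) n - ((jb n ^ s : ℝ) : ℂ) * conv3 (a t) (a t) (a t) n)) = _
    generalize conv3 (a t) (a t) (a t) n = C at *
    generalize ((jb n ^ (-s) : ℝ) : ℂ) = P at *
    generalize ((jb n ^ s : ℝ) : ℂ) = P' at *
    generalize ((jb n ^ (-1:ℝ) : ℝ) : ℂ) = Q at *
    generalize (jb n : ℂ) = J at *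
    generalize ((nsqZ n : ℝ) : ℂ) = N at *
    linear_combination (-C) * e2 + (-P * Q * RX (z t) n) * e3 + (P * J * RX (z t) n) * e4
  · intro n
    change ja s (RX (z 0)) n = a₀ n
    rw [hz0, RX_comb _ _ hA hB, ja_mkX]
  · intro n
    rw [hd1]
    simp only [b]
    rw [hz0, BX_comb _ _ hA hB, mkX_apply, ← mul_assoc, mul_comm ((jb n ^ (-s) : ℝ) : ℂ), jb_cancel, one_mul]

set_option maxHeartbeats 2000000 in
lemma sol_w (s : ℝ) (hs : 0 ≤ s) (a₀ b₀ : ZZ3 → ℂ)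
    (hna : hNormSq (1+s) a₀ ≠ ⊤) (hnb : hNormSq s b₀ ≠ ⊤) (a : ℝ → ZZ3 → ℂ) (h : IsSol s a₀ b₀ a) :
    ∃ w : ℝ → XX, w 0 = mkX (1+s) a₀ hna + IX (mkX s b₀ hnb) ∧ (∀ t, HasDerivAt w (GG s hs t (w t)) t) ∧
      ∀ t, a t = ja s (RX (VX (-t) (w t))) := by
  obtain ⟨h1, h2, h3, h4, h5, h6⟩ := h
  let b : ℝ → ZZ3 → ℂ := fun t n => deriv (fun t' => a t' n) t
  have hda : ∀ t n, HasDerivAt (fun t => a t n) (b t n) t := fun t n =>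
    ((h1 n).differentiable (by norm_num) t).hasDerivAt
  have hdb : ∀ t n, HasDerivAt (fun t => b t n) (-(((nsqZ n : ℝ)) : ℂ) * a t n - conv3 (a t) (a t) (a t) n) t := by
    intro t n
    have h := h1 n
    rw [show (2 : WithTop ℕ∞) = 1 + 1 by norm_num, contDiff_succ_iff_deriv] at h
    have := (h.2.2.differentiable (by norm_num) t).hasDerivAt
    exact this.congr_deriv (h4 t n).2
  have hbH : ∀ t, HermSymm (b t) := by
    intro t n
    have e1 := hda t (-n)
    have e2 := Complex.conjCLE.hasFDerivAt.comp_hasDerivAt t (hda t n)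
    have e3 : (fun t => a t (-n)) = Complex.conjCLE ∘ fun t => a t n := by
      funext u; exact h2 u n
    rw [e3] at e1
    exact e1.unique e2
  have hfin : ∀ t, hNormSq (1+s) (a t) ≠ ⊤ ∧ hNormSq s (b t) ≠ ⊤ := by
    intro t
    obtain ⟨M, hM, hb⟩ := h3 (|t| + 1) (by positivity)
    have h := hb t (abs_le.1 (by linarith))
    constructor
    · intro e
      rw [e, ENNReal.top_rpow_of_pos (by norm_num), top_add] at h
      exact hM (top_le_iff.1 h)
    · intro e
      change _ + hNormSq s (b t) ^ (1/2:ℝ) ≤ M at h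
      rw [e, ENNReal.top_rpow_of_pos (by norm_num), add_top] at h
      exact hM (top_le_iff.1 h)
  let xa : ℝ → XX := fun t => mkX (1+s) (a t) (hfin t).1
  let xb : ℝ → XX := fun t => mkX s (b t) (hfin t).2
  let z : ℝ → XX := fun t => xa t + IX (xb t)
  have hR : ∀ t, RX (z t) = xa t := fun t => RX_comb _ _ (mkX_herm _ _ _ (h2 t)) (mkX_herm _ _ _ (hbH t))
  have hja : ∀ t, ja s (xa t) = a t := fun t => ja_mkX s (a t) _
  let w : ℝ → XX := fun t => VX t (z t)
  have hzw : ∀ t, VX (-t) (w t) = z t := fun t => VX_neg' t (z t)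
  have hcomp : ∀ t n, HasDerivAt (fun t => w t n) (GG s hs t (w t) n) t := by
    intro t n
    have e1 : HasDerivAt (fun t => z t n) (((jb n ^ (1+s) : ℝ) : ℂ) * b t n + Complex.I * (((jb n ^ s : ℝ) : ℂ) *
        (-(((nsqZ n : ℝ)) : ℂ) * a t n - conv3 (a t) (a t) (a t) n))) t :=
      ((hda t n).const_mul _).add (((hdb t n).const_mul _).const_mul _)
    have e2 : HasDerivAt (fun u : ℝ => Complex.exp (((u * jb n : ℝ) : ℂ) * Complex.I))
      (Complex.exp (((t * jb n : ℝ) : ℂ) * Complex.I) * (((1 * jb n : ℝ) : ℂ) * Complex.I)) t := by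
      have h3 : HasDerivAt (fun u : ℝ => u * jb n) (1 * jb n) t := (hasDerivAt_id t).mul_const _
      exact (h3.ofReal_comp.mul_const Complex.I).cexp
    refine (e2.mul e1).congr_deriv ?_
    rw [GG, hzw, IX_apply, VX_apply, FF_apply, hR, hja]
    change _ * z t n + _ = Complex.I * (_ * (((jb n ^ (-1:ℝ) : ℝ) : ℂ) * (((jb n ^ (1+s) : ℝ) : ℂ) * a t n) - _))
    have ez : z t n = ((jb n ^ (1+s) : ℝ) : ℂ) * a t n + Complex.I * (((jb n ^ s : ℝ) : ℂ) * b t n) := rfl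
    have e3 := jb_sqC n
    have e4 : (jb n : ℂ) * ((jb n ^ (-1:ℝ) : ℝ) : ℂ) = 1 := by
      have := jb_cancel 1 n
      rwa [Real.rpow_one] at this
    rw [ez, jb_split, one_mul]
    generalize conv3 (a t) (a t) (a t) n = C at *
    generalize ((jb n ^ s : ℝ) : ℂ) = P at *
    generalize ((jb n ^ (-1:ℝ) : ℝ) : ℂ) = Q at *
    generalize Complex.exp (((t * jb n : ℝ) : ℂ) * Complex.I) = X at *
    generalize (jb n : ℂ) = J at *
    generalize ((nsqZ n : ℝ) : ℂ) = N at *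
    linear_combination (X * J * P * b t n) * Complex.I_sq + (Complex.I * X * P * a t n) * e3
      - (Complex.I * X * P * a t n) * e4
  have hbd : ∀ t : ℝ, ∃ C, ∀ᶠ u in 𝓝 t, ‖GG s hs u (w u)‖ ≤ C := by
    intro t
    obtain ⟨M, hM, hb⟩ := h3 (|t| + 1) (by positivity)
    refine ⟨lipF s M.toReal * M.toReal, ?_⟩
    have : ∀ᶠ u in nhds t, |u| < |t| + 1 :=
      continuous_abs.continuousAt.eventually_lt continuousAt_const (lt_add_one _)
    filter_upwards [this] with u hu
    apply GG_bdd
    change ‖VX u (z u)‖ ≤ _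
    rw [VX_norm]
    have h := hb u (abs_le.1 hu.le)
    have e1 : ‖xa u‖ₑ = hNormSq (1+s) (a u) ^ (1/2:ℝ) := mkX_norm _ _ _
    have e2 : ‖xb u‖ₑ = hNormSq s (b u) ^ (1/2:ℝ) := mkX_norm _ _ _
    change _ + hNormSq s (b u) ^ (1/2:ℝ) ≤ M at h
    rw [← e1, ← e2] at h
    have h' := ENNReal.toReal_mono hM h
    rw [ENNReal.toReal_add enorm_ne_top enorm_ne_top, toReal_enorm, toReal_enorm] at h'
    refine le_trans ((norm_add_le _ _).trans ?_) h'
    gcongr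
    exact IX_norm_le _
  have hwc : Continuous w := by
    rw [continuous_iff_continuousAt]
    intro t
    obtain ⟨C, hC⟩ := hbd t
    exact comp_continuousAt w (fun u => GG s hs u (w u)) t C (Eventually.of_forall fun u n => hcomp u n) hC
  have hgc : Continuous fun u => GG s hs u (w u) := GG_cont_w s hs w hwc
  refine ⟨w, ?_, ?_, ?_⟩
  · change VX 0 (z 0) = _
    rw [VX_zero]
    have e1 : a 0 = a₀ := funext h5
    have e2 : b 0 = b₀ := funext h6
    apply lp.ext; funext n
    change ((jb n ^ (1+s) : ℝ) : ℂ) * a 0 n + Complex.I * (((jb n ^ s : ℝ) : ℂ) * b 0 n) =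
      ((jb n ^ (1+s) : ℝ) : ℂ) * a₀ n + Complex.I * (((jb n ^ s : ℝ) : ℂ) * b₀ n)
    rw [e1, e2]
  · intro t
    exact comp_hasDerivAt w (fun u => GG s hs u (w u)) t (Eventually.of_forall fun u n => hcomp u n) hgc.continuousAt
  · intro t
    rw [hzw, hR, hja]

lemma sol_unique (s : ℝ) (hs : 0 ≤ s) (a₀ b₀ : ZZ3 → ℂ)
    (hna : hNormSq (1+s) a₀ ≠ ⊤) (hnb : hNormSq s b₀ ≠ ⊤) (a a' : ℝ → ZZ3 → ℂ) (h : IsSol s a₀ b₀ a)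
    (h' : IsSol s a₀ b₀ a') : a = a' := by
  obtain ⟨w, hw0, hw, hwa⟩ := sol_w s hs a₀ b₀ hna hnb a h
  obtain ⟨v, hv0, hv, hva⟩ := sol_w s hs a₀ b₀ hna hnb a' h'
  funext t
  have := ode_unique (GG s hs) (lipF s) (lipF_nonneg s) (GG_lip s hs) (|t| + 1) (by positivity) w v
    (fun u _ => (hw u).continuousAt.continuousWithinAt) (fun u _ => (hv u).continuousAt.continuousWithinAt)
    (fun u _ => hw u) (fun u _ => hv u) (hw0.trans hv0.symm) (abs_le.1 (by linarith) : t ∈ Icc (-(|t|+1)) (|t|+1))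
  rw [hwa, hva, this]

end final

theorem nlw_gwp (σ : ℝ) (hσ : 1 ≤ σ)
    (a₀ b₀ : (Fin 3 → ℤ) → ℂ)
    (ha₀sym : HermSymm a₀) (hb₀sym : HermSymm b₀)
    (ha₀ : hNormSq σ a₀ ≠ ⊤) (hb₀ : hNormSq (σ - 1) b₀ ≠ ⊤) :
    ∃! a : ℝ → (Fin 3 → ℤ) → ℂ,
      (∀ n, ContDiff ℝ 2 (fun t => a t n)) ∧
      (∀ t, HermSymm (a t)) ∧
      (∀ T : ℝ, 0 < T → ∃ M : ℝ≥0∞, M ≠ ⊤ ∧ ∀ t ∈ Set.Icc (-T) T,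
          hNormSq σ (a t) ^ (1/2 : ℝ)
            + hNormSq (σ - 1) (fun n => deriv (fun t' => a t' n) t) ^ (1/2 : ℝ) ≤ M) ∧
      (∀ (t : ℝ) (n : Fin 3 → ℤ),
          Summable (fun p : (Fin 3 → ℤ) × (Fin 3 → ℤ) =>
            a t p.1 * a t p.2 * a t (n - p.1 - p.2)) ∧
          deriv (deriv (fun t' => a t' n)) t
            = -(((nsqZ n : ℝ)) : ℂ) * a t n
              - ∑' p : (Fin 3 → ℤ) × (Fin 3 → ℤ), a t p.1 * a t p.2 * a t (n - p.1 - p.2)) ∧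
      (∀ n, a 0 n = a₀ n) ∧
      (∀ n, deriv (fun t => a t n) 0 = b₀ n) := by
  obtain ⟨s, rfl⟩ : ∃ s, σ = 1 + s := ⟨σ - 1, by ring⟩
  have hs : 0 ≤ s := by linarith
  simp only [add_sub_cancel_left] at hb₀ ⊢
  obtain ⟨a, ha⟩ := sol_exists s hs a₀ b₀ ha₀sym hb₀sym ha₀ hb₀
  exact ⟨a, ha, fun a' ha' => sol_unique s hs a₀ b₀ ha₀ hb₀ a' a ha' ha⟩
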